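/- arXiv:1601.03332 — 2 statements merged into one kernel-verified Lean document; each statement's English description precedes it below -/
import Mathlib

section
/- There exists a universal constant C ∈ (0, ∞) such that for every p ∈ [2, ∞), every n ∈ ℕ, every k ∈ [n], and every h ∈ L_p^0({−1,1}^n), ( (1/binom(n,k)) Σ_{S ⊆ [n], |S| = k} ‖E_{[n]∖S} h‖_p^p )^{1/p} ≤ C·(p^{5/2}/√(log p))·(k/n)^{1/p}·( Σ_{j=1}^n ‖∂_j h‖_p^p )^{1/p} + C·(p^4/log p)·√(k/n)·‖h‖_p. -/
open Finset

/-- The normalized `L_p` norm of a function on the discrete hypercube `{-1,1}^n`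
(coordinates encoded by `Bool`). -/
noncomputable def pnorm {n : ℕ} (p : ℝ) (h : (Fin n → Bool) → ℝ) : ℝ :=
  ((∑ ε : Fin n → Bool, |h ε| ^ p) / 2 ^ n) ^ (1 / p)

/-- The hypercube partial derivative `∂_j h (ε) = h(ε) - h(ε with j-th coordinate flipped)`. -/
noncomputable def dflip {n : ℕ} (j : Fin n) (h : (Fin n → Bool) → ℝ) :
    (Fin n → Bool) → ℝ :=
  fun ε => h ε - h (Function.update ε j (!ε j))

/-- `E_S h`: averaging of `h` over the coordinates in `S`. -/
noncomputable def condAvg {n : ℕ} (S : Finset (Fin n)) (h : (Fin n → Bool) → ℝ) :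
    (Fin n → Bool) → ℝ :=
  fun ε => (∑ δ : Fin n → Bool, h (fun j => if j ∈ S then δ j else ε j)) / 2 ^ n

/-! ### Elementary inequalities for real powers -/

theorem rpow_eq_self_mul_rpow_sub_one {b q : ℝ} (hb : 0 ≤ b) (hq : 1 ≤ q) :
    b ^ q = b * b ^ (q - 1) := by
  rcases hb.eq_or_lt with rfl | hb
  · rw [Real.zero_rpow (by linarith), zero_mul]
  · rw [Real.rpow_sub_one hb.ne']
    field_simp

theorem mul_rpow_sub_one_le {x y q : ℝ} (hx : 0 ≤ x) (hy : 0 ≤ y) (hq : 1 ≤ q) :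
    x * y ^ (q - 1) ≤ x ^ q / q + (1 - 1 / q) * y ^ q := by
  have hq0 : 0 < q := by linarith
  have h1q : 1 / q ≤ 1 := by rw [div_le_one hq0]; exact hq
  have h := Real.geom_mean_le_arith_mean2_weighted (w₁ := 1 / q) (w₂ := 1 - 1 / q)
    (p₁ := x ^ q) (p₂ := y ^ q) (by positivity) (by linarith) (by positivity) (by positivity)
    (by ring)
  rw [← Real.rpow_mul hx, ← Real.rpow_mul hy] at h
  have e1 : q * (1 / q) = 1 := by field_simp
  have e2 : q * (1 - 1 / q) = q - 1 := by field_simp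
  rw [e1, e2, Real.rpow_one] at h
  calc _ ≤ _ := h
    _ = _ := by ring

theorem rpow_sub_rpow_le {a b q : ℝ} (ha : 0 ≤ a) (hb : 0 ≤ b) (hq : 1 ≤ q) :
    b ^ q - a ^ q ≤ q * b ^ (q - 1) * (b - a) := by
  have hq0 : 0 < q := by linarith
  have h := mul_le_mul_of_nonneg_left (mul_rpow_sub_one_le ha hb hq) hq0.le
  have e : q * (a ^ q / q + (1 - 1 / q) * b ^ q) = a ^ q + (q - 1) * b ^ q := by
    field_simp
  rw [e] at h
  have hbq := rpow_eq_self_mul_rpow_sub_one hb hq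
  have : q * b ^ (q - 1) * (b - a) = q * b ^ q - q * (a * b ^ (q - 1)) := by rw [hbq]; ring
  rw [this]
  linarith

/-- If `∑ B ^ q` is controlled by `∑ A * B ^ (q - 1)`, Young's inequality absorbs the factor
`B ^ (q - 1)`. -/
theorem sum_rpow_le_of_le_sum_mul_rpow {ι : Type*} (s : Finset ι) {A B : ι → ℝ} {q K c : ℝ}
    (hA : ∀ i ∈ s, 0 ≤ A i) (hB : ∀ i ∈ s, 0 ≤ B i) (hq : 1 ≤ q) (hK : 0 ≤ K)
    (h : ∑ i ∈ s, B i ^ q ≤ c + K * ∑ i ∈ s, A i * B i ^ (q - 1)) :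
    ∑ i ∈ s, B i ^ q ≤ q * c + K ^ q * ∑ i ∈ s, A i ^ q := by
  have hq0 : 0 < q := by linarith
  have key : K * ∑ i ∈ s, A i * B i ^ (q - 1) ≤
      K ^ q * (∑ i ∈ s, A i ^ q) / q + (1 - 1 / q) * ∑ i ∈ s, B i ^ q := by
    rw [mul_sum, mul_sum, mul_sum, sum_div, ← sum_add_distrib]
    refine sum_le_sum fun i hi => ?_
    have := mul_rpow_sub_one_le (mul_nonneg hK (hA i hi)) (hB i hi) hq
    rwa [Real.mul_rpow hK (hA i hi), mul_assoc] at this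
  have h2 := mul_le_mul_of_nonneg_left (h.trans (add_le_add le_rfl key)) hq0.le
  have e : q * (c + (K ^ q * (∑ i ∈ s, A i ^ q) / q + (1 - 1 / q) * ∑ i ∈ s, B i ^ q)) =
      q * c + K ^ q * (∑ i ∈ s, A i ^ q) + (q - 1) * ∑ i ∈ s, B i ^ q := by
    field_simp
    ring
  rw [e] at h2
  linarith

theorem two_mul_rpow_le_add_rpow {a b c r : ℝ} (ha : 0 ≤ a) (hb : 0 ≤ b) (hc : 0 ≤ c)
    (hr : 0 ≤ r) (h : a ^ 2 ≤ b * c) : 2 * a ^ r ≤ b ^ r + c ^ r := by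
  have h1 : (a ^ r) ^ 2 ≤ b ^ r * c ^ r := by
    rw [← Real.mul_rpow hb hc, ← Real.rpow_natCast (a ^ r), ← Real.rpow_mul ha, mul_comm,
      Real.rpow_mul ha, Real.rpow_natCast]
    exact Real.rpow_le_rpow (by positivity) h hr
  have h2 : 0 ≤ b ^ r := by positivity
  have h3 : 0 ≤ c ^ r := by positivity
  refine abs_le_of_sq_le_sq' ?_ (by positivity) |>.2
  nlinarith [sq_nonneg (b ^ r - c ^ r)]

theorem mul_rpow_sub_rpow_le {b c q u d : ℝ} (hc : 0 ≤ c) (hq : 1 ≤ q) (hu : 0 ≤ u)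
    (hbc : b - c = 4 * u) (hub : u ^ 2 ≤ b * d ^ 2) :
    u * (b ^ (q - 1) - c ^ (q - 1)) ≤ 4 * q * d ^ 2 * b ^ (q - 1) := by
  have hcb : c ≤ b := by linarith
  have hb : 0 ≤ b := hc.trans hcb
  rcases hb.eq_or_lt with rfl | hb0
  · have hu0 : u = 0 := by nlinarith
    subst hu0
    rw [zero_mul]
    positivity
  have hbr : 0 ≤ b ^ (q - 1) := by positivity
  have h1 := rpow_sub_rpow_le hc hb hq
  have h2 : c * c ^ (q - 1) ≤ b * c ^ (q - 1) :=
    mul_le_mul_of_nonneg_right hcb (by positivity)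
  rw [rpow_eq_self_mul_rpow_sub_one hb hq, rpow_eq_self_mul_rpow_sub_one hc hq, hbc] at h1
  have h3 : b * (b ^ (q - 1) - c ^ (q - 1)) ≤ q * b ^ (q - 1) * (4 * u) := by linarith
  have h4 := mul_le_mul_of_nonneg_left h3 hu
  have h5 := mul_le_mul_of_nonneg_left hub (show 0 ≤ 4 * q * b ^ (q - 1) by positivity)
  refine le_of_mul_le_mul_left ?_ hb0
  calc _ = u * (b * (b ^ (q - 1) - c ^ (q - 1))) := by ring
    _ ≤ _ := h4
    _ = 4 * q * b ^ (q - 1) * u ^ 2 := by ring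
    _ ≤ _ := h5
    _ = _ := by ring

theorem add_sq_rpow_two_point_le_of_nonneg {x d s q : ℝ} (hs : 0 ≤ s) (hq : 1 ≤ q)
    (hxd : 0 ≤ x * d) :
    ((x + d) ^ 2 + (s + d ^ 2)) ^ q + ((x - d) ^ 2 + (s + d ^ 2)) ^ q ≤
      2 * (x ^ 2 + s) ^ q + 10 * q ^ 2 * (d ^ 2 * ((x + d) ^ 2 + (s + d ^ 2)) ^ (q - 1) +
        d ^ 2 * ((x - d) ^ 2 + (s + d ^ 2)) ^ (q - 1)) := by
  set b := (x + d) ^ 2 + (s + d ^ 2) with hb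
  set c := (x - d) ^ 2 + (s + d ^ 2) with hc
  have hA : 0 ≤ x ^ 2 + s := by positivity
  have hb0 : 0 ≤ b := by positivity
  have hc0 : 0 ≤ c := by positivity
  have hbr : 0 ≤ b ^ (q - 1) := by positivity
  have hcr : 0 ≤ c ^ (q - 1) := by positivity
  have h1 := rpow_sub_rpow_le hA hb0 hq
  have h2 := rpow_sub_rpow_le hA hc0 hq
  have h3 := mul_rpow_sub_rpow_le (b := b) (d := d) hc0 hq hxd (by rw [hb, hc]; ring)
    (by rw [hb, mul_pow]; exact mul_le_mul_of_nonneg_right (by nlinarith) (by positivity))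
  have e1 : b - (x ^ 2 + s) = 2 * d ^ 2 + 2 * (x * d) := by rw [hb]; ring
  have e2 : c - (x ^ 2 + s) = 2 * d ^ 2 - 2 * (x * d) := by rw [hc]; ring
  rw [e1] at h1
  rw [e2] at h2
  have h4 := mul_le_mul_of_nonneg_left h3 (show 0 ≤ 2 * q by linarith)
  have hqq : q ≤ q ^ 2 := by nlinarith
  have h5 := mul_le_mul_of_nonneg_right hqq
    (show 0 ≤ 2 * d ^ 2 * (b ^ (q - 1) + c ^ (q - 1)) by positivity)
  have h6 : 0 ≤ 8 * q ^ 2 * (d ^ 2 * c ^ (q - 1)) := by positivity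
  linarith

theorem add_sq_rpow_two_point_le {x d s q : ℝ} (hs : 0 ≤ s) (hq : 1 ≤ q) :
    ((x + d) ^ 2 + (s + d ^ 2)) ^ q + ((x - d) ^ 2 + (s + d ^ 2)) ^ q ≤
      2 * (x ^ 2 + s) ^ q + 10 * q ^ 2 * (d ^ 2 * ((x + d) ^ 2 + (s + d ^ 2)) ^ (q - 1) +
        d ^ 2 * ((x - d) ^ 2 + (s + d ^ 2)) ^ (q - 1)) := by
  rcases le_total 0 (x * d) with h | h
  · exact add_sq_rpow_two_point_le_of_nonneg hs hq h
  · have := add_sq_rpow_two_point_le_of_nonneg (x := x) (d := -d) hs hq (by linarith)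
    simp only [neg_sq, ← sub_eq_add_neg, sub_neg_eq_add] at this
    linarith

theorem two_mul_add_sq_rpow_le {x d s r : ℝ} (hs : 0 ≤ s) (hr : 0 ≤ r) :
    2 * (x ^ 2 + s) ^ r ≤
      ((x + d) ^ 2 + (s + d ^ 2)) ^ r + ((x - d) ^ 2 + (s + d ^ 2)) ^ r := by
  refine two_mul_rpow_le_add_rpow (by positivity) (by positivity) (by positivity) hr ?_
  have : ((x + d) ^ 2 + (s + d ^ 2)) * ((x - d) ^ 2 + (s + d ^ 2)) =
    (x ^ 2 + s) ^ 2 + 4 * d ^ 2 * s + 4 * (d ^ 2) ^ 2 := by ring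
  rw [this]
  have : 0 ≤ 4 * d ^ 2 * s := by positivity
  nlinarith [sq_nonneg (d ^ 2)]

/-! ### Square function inequalities for conditionally symmetric martingales -/

theorem sum_le_sum_of_involutive {Ω : Type*} [Fintype Ω] {τ : Ω → Ω}
    (hτ : Function.Involutive τ) {f g : Ω → ℝ} (h : ∀ ω, f ω + f (τ ω) ≤ g ω + g (τ ω)) :
    ∑ ω, f ω ≤ ∑ ω, g ω := by
  have e (u : Ω → ℝ) : ∑ ω, u (τ ω) = ∑ ω, u ω := hτ.bijective.sum_comp u
  have := sum_le_sum fun ω (_ : ω ∈ (univ : Finset Ω)) => h ω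
  rw [sum_add_distrib, sum_add_distrib, e, e] at this
  linarith

section Martingale

variable {Ω : Type*} {τ : ℕ → Ω → Ω} {d : ℕ → Ω → ℝ} {q : ℝ}

/-- The sequence `d` is a sequence of martingale differences, conditionally symmetric with respect
to the involutions `τ`. -/
structure IsSymmDiff (τ : ℕ → Ω → Ω) (d : ℕ → Ω → ℝ) : Prop where
  involutive : ∀ m, Function.Involutive (τ m)
  apply_self : ∀ m ω, d m (τ m ω) = -d m ω
  apply_of_lt : ∀ i m, i < m → ∀ ω, d i (τ m ω) = d i ω

theorem IsSymmDiff.sum_apply (h : IsSymmDiff τ d) (m : ℕ) (ω : Ω) :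
    ∑ i ∈ range m, d i (τ m ω) = ∑ i ∈ range m, d i ω :=
  sum_congr rfl fun i hi => h.apply_of_lt i m (mem_range.1 hi) ω

theorem IsSymmDiff.sum_sq_apply (h : IsSymmDiff τ d) (m : ℕ) (ω : Ω) :
    ∑ i ∈ range m, d i (τ m ω) ^ 2 = ∑ i ∈ range m, d i ω ^ 2 :=
  sum_congr rfl fun i hi => by rw [h.apply_of_lt i m (mem_range.1 hi) ω]

variable [Fintype Ω]

theorem IsSymmDiff.sum_squareFunction_rpow_le_aux (h : IsSymmDiff τ d) (hq : 1 ≤ q) (m : ℕ) :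
    ∑ ω, (∑ i ∈ range m, d i ω ^ 2) ^ q ≤
      q * ∑ ω, (∑ i ∈ range m, d i ω) ^ 2 * (∑ i ∈ range m, d i ω ^ 2) ^ (q - 1) := by
  induction m with
  | zero => simp [Real.zero_rpow (show q ≠ 0 by linarith)]
  | succ m ih =>
    have h1 : ∑ ω, ((∑ i ∈ range m, d i ω) ^ 2 * (∑ i ∈ range m, d i ω ^ 2) ^ (q - 1) +
        d m ω ^ 2 * (∑ i ∈ range (m + 1), d i ω ^ 2) ^ (q - 1)) ≤
        ∑ ω, (∑ i ∈ range (m + 1), d i ω) ^ 2 *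
          (∑ i ∈ range (m + 1), d i ω ^ 2) ^ (q - 1) := by
      refine sum_le_sum_of_involutive (h.involutive m) fun ω => ?_
      simp only [sum_range_succ, h.sum_apply, h.sum_sq_apply, h.apply_self, neg_sq]
      have hQ : 0 ≤ ∑ i ∈ range m, d i ω ^ 2 := by positivity
      have := Real.rpow_le_rpow (z := q - 1) hQ
        (le_add_of_nonneg_right (sq_nonneg (d m ω))) (by linarith)
      nlinarith [mul_le_mul_of_nonneg_left this (sq_nonneg (∑ i ∈ range m, d i ω))]
    have h2 : ∑ ω, (∑ i ∈ range (m + 1), d i ω ^ 2) ^ q ≤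
        ∑ ω, (∑ i ∈ range m, d i ω ^ 2) ^ q +
          q * ∑ ω, d m ω ^ 2 * (∑ i ∈ range (m + 1), d i ω ^ 2) ^ (q - 1) := by
      rw [mul_sum, ← sum_add_distrib]
      refine sum_le_sum fun ω _ => ?_
      have := rpow_sub_rpow_le (a := ∑ i ∈ range m, d i ω ^ 2)
        (b := ∑ i ∈ range (m + 1), d i ω ^ 2) (by positivity) (by positivity) hq
      have e : ∑ i ∈ range (m + 1), d i ω ^ 2 - ∑ i ∈ range m, d i ω ^ 2 = d m ω ^ 2 := by
        rw [sum_range_succ]; ring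
      rw [e] at this
      linarith
    rw [sum_add_distrib] at h1
    nlinarith [mul_le_mul_of_nonneg_left h1 (show 0 ≤ q by linarith)]

theorem IsSymmDiff.sum_squareFunction_rpow_le (h : IsSymmDiff τ d) (hq : 1 ≤ q) (m : ℕ) :
    ∑ ω, (∑ i ∈ range m, d i ω ^ 2) ^ q ≤
      q ^ q * ∑ ω, ((∑ i ∈ range m, d i ω) ^ 2) ^ q := by
  have := sum_rpow_le_of_le_sum_mul_rpow univ (A := fun ω => (∑ i ∈ range m, d i ω) ^ 2)
    (B := fun ω => ∑ i ∈ range m, d i ω ^ 2) (q := q) (K := q) (c := 0)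
    (fun _ _ => by positivity) (fun _ _ => by positivity) hq (by linarith)
    (by rw [zero_add]; exact h.sum_squareFunction_rpow_le_aux hq m)
  simpa using this

theorem IsSymmDiff.sum_add_squareFunction_rpow_le_aux (h : IsSymmDiff τ d) (hq : 1 ≤ q)
    (m : ℕ) :
    ∑ ω, ((∑ i ∈ range m, d i ω) ^ 2 + ∑ i ∈ range m, d i ω ^ 2) ^ q ≤
      10 * q ^ 2 * ∑ ω, (∑ i ∈ range m, d i ω ^ 2) *
        ((∑ i ∈ range m, d i ω) ^ 2 + ∑ i ∈ range m, d i ω ^ 2) ^ (q - 1) := by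
  induction m with
  | zero => simp [Real.zero_rpow (show q ≠ 0 by linarith)]
  | succ m ih =>
    have h1 : ∑ ω, ((∑ i ∈ range m, d i ω ^ 2) *
          ((∑ i ∈ range m, d i ω) ^ 2 + ∑ i ∈ range m, d i ω ^ 2) ^ (q - 1) +
        d m ω ^ 2 * ((∑ i ∈ range (m + 1), d i ω) ^ 2 +
          ∑ i ∈ range (m + 1), d i ω ^ 2) ^ (q - 1)) ≤
        ∑ ω, (∑ i ∈ range (m + 1), d i ω ^ 2) *
          ((∑ i ∈ range (m + 1), d i ω) ^ 2 + ∑ i ∈ range (m + 1), d i ω ^ 2) ^ (q - 1) := by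
      refine sum_le_sum_of_involutive (h.involutive m) fun ω => ?_
      simp only [sum_range_succ, h.sum_apply, h.sum_sq_apply, h.apply_self, neg_sq,
        ← sub_eq_add_neg]
      have hQ : 0 ≤ ∑ i ∈ range m, d i ω ^ 2 := by positivity
      have := two_mul_add_sq_rpow_le (x := ∑ i ∈ range m, d i ω) (d := d m ω) hQ
        (show 0 ≤ q - 1 by linarith)
      linarith [mul_le_mul_of_nonneg_left this hQ]
    have h2 : ∑ ω, ((∑ i ∈ range (m + 1), d i ω) ^ 2 +
          ∑ i ∈ range (m + 1), d i ω ^ 2) ^ q ≤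
        ∑ ω, (((∑ i ∈ range m, d i ω) ^ 2 + ∑ i ∈ range m, d i ω ^ 2) ^ q +
          10 * q ^ 2 * (d m ω ^ 2 * ((∑ i ∈ range (m + 1), d i ω) ^ 2 +
            ∑ i ∈ range (m + 1), d i ω ^ 2) ^ (q - 1))) := by
      refine sum_le_sum_of_involutive (h.involutive m) fun ω => ?_
      simp only [sum_range_succ, h.sum_apply, h.sum_sq_apply, h.apply_self, neg_sq,
        ← sub_eq_add_neg]
      have := add_sq_rpow_two_point_le (x := ∑ i ∈ range m, d i ω) (d := d m ω)
        (s := ∑ i ∈ range m, d i ω ^ 2) (by positivity) hq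
      linarith
    rw [sum_add_distrib] at h1 h2
    rw [← mul_sum] at h2
    have := mul_le_mul_of_nonneg_left h1 (show 0 ≤ 10 * q ^ 2 by positivity)
    linarith

theorem IsSymmDiff.sum_rpow_le_squareFunction (h : IsSymmDiff τ d) (hq : 1 ≤ q) (m : ℕ) :
    ∑ ω, ((∑ i ∈ range m, d i ω) ^ 2) ^ q ≤
      (10 * q ^ 2) ^ q * ∑ ω, (∑ i ∈ range m, d i ω ^ 2) ^ q := by
  have := sum_rpow_le_of_le_sum_mul_rpow univ (A := fun ω => ∑ i ∈ range m, d i ω ^ 2)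
    (B := fun ω => (∑ i ∈ range m, d i ω) ^ 2 + ∑ i ∈ range m, d i ω ^ 2)
    (q := q) (K := 10 * q ^ 2) (c := 0)
    (fun _ _ => by positivity) (fun _ _ => by positivity) hq (by positivity)
    (by rw [zero_add]; exact h.sum_add_squareFunction_rpow_le_aux hq m)
  rw [mul_zero, zero_add] at this
  refine le_trans (sum_le_sum fun ω _ => ?_) this
  exact Real.rpow_le_rpow (by positivity) (le_add_of_nonneg_right (by positivity)) (by linarith)

end Martingale

/-! ### Sampling without replacement -/

section Sampling

variable {ι : Type*} [DecidableEq ι]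

theorem erase_subset_map_swap {S : Finset ι} {i j : ι} (hj : j ∈ S) :
    S.erase j ⊆ S.map (Equiv.swap i j).toEmbedding := by
  intro x hx
  obtain ⟨hxj, hxS⟩ := mem_erase.1 hx
  rw [mem_map_equiv, Equiv.symm_swap]
  by_cases hxi : x = i
  · rw [hxi, Equiv.swap_apply_left]
    exact hj
  · rwa [Equiv.swap_apply_of_ne_of_ne hxi hxj]

variable [Fintype ι]

theorem sum_filter_mem_map_swap (φ : Finset ι → ℝ) (k : ℕ) (i j : ι) :
    ∑ S ∈ (powersetCard k univ).filter (j ∈ ·), φ (S.map (Equiv.swap i j).toEmbedding) =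
      ∑ S ∈ (powersetCard k univ).filter (i ∈ ·), φ S := by
  refine sum_nbij' (fun S => S.map (Equiv.swap i j).toEmbedding)
    (fun S => S.map (Equiv.swap i j).toEmbedding) ?_ ?_ ?_ ?_ ?_
  · intro S hS
    simp_all [mem_powersetCard, mem_map_equiv]
  · intro S hS
    simp_all [mem_powersetCard, mem_map_equiv]
  · intro S _
    ext x
    simp [mem_map_equiv]
  · intro S _
    ext x
    simp [mem_map_equiv]
  · intro S _
    rfl

theorem card_mul_sum_erase_le {φ : Finset ι → ℝ} (hφ : Monotone φ) (k : ℕ) (j : ι) :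
    (Fintype.card ι : ℝ) * ∑ S ∈ (powersetCard k univ).filter (j ∈ ·), φ (S.erase j) ≤
      k * ∑ S ∈ powersetCard k univ, φ S := by
  calc (Fintype.card ι : ℝ) * ∑ S ∈ (powersetCard k univ).filter (j ∈ ·), φ (S.erase j)
      = ∑ _i : ι, ∑ S ∈ (powersetCard k univ).filter (j ∈ ·), φ (S.erase j) := by
        rw [sum_const, nsmul_eq_mul, card_univ]
    _ ≤ ∑ i : ι, ∑ S ∈ (powersetCard k univ).filter (j ∈ ·),
          φ (S.map (Equiv.swap i j).toEmbedding) :=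
        sum_le_sum fun i _ => sum_le_sum fun S hS =>
          hφ (erase_subset_map_swap (mem_filter.1 hS).2)
    _ = ∑ i : ι, ∑ S ∈ (powersetCard k univ).filter (i ∈ ·), φ S :=
        sum_congr rfl fun i _ => sum_filter_mem_map_swap φ k i j
    _ = ∑ S ∈ powersetCard k univ, ∑ i : ι, if i ∈ S then φ S else 0 := by
        simp_rw [sum_filter]
        exact sum_comm
    _ = k * ∑ S ∈ powersetCard k univ, φ S := by
        rw [mul_sum]
        refine sum_congr rfl fun S hS => ?_
        rw [sum_ite_mem, univ_inter, sum_const, nsmul_eq_mul, (mem_powersetCard.1 hS).2]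

theorem sum_sum_mul_erase_le [Nonempty ι] {φ : Finset ι → ℝ} (hφ : Monotone φ) (k : ℕ)
    {w : ι → ℝ} (hw : ∀ i, 0 ≤ w i) :
    ∑ S ∈ powersetCard k univ, ∑ j ∈ S, w j * φ (S.erase j) ≤
      (k / Fintype.card ι) * (∑ j, w j) * ∑ S ∈ powersetCard k univ, φ S := by
  have hN : (0 : ℝ) < Fintype.card ι := by exact_mod_cast Fintype.card_pos
  calc ∑ S ∈ powersetCard k univ, ∑ j ∈ S, w j * φ (S.erase j)
      = ∑ S ∈ powersetCard k univ, ∑ j, if j ∈ S then w j * φ (S.erase j) else 0 := by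
        simp only [sum_ite_mem, univ_inter]
    _ = ∑ j, w j * ∑ S ∈ (powersetCard k univ).filter (j ∈ ·), φ (S.erase j) := by
        rw [sum_comm]
        simp_rw [mul_sum, sum_filter]
    _ ≤ ∑ j, w j * ((k / Fintype.card ι) * ∑ S ∈ powersetCard k univ, φ S) := by
        refine sum_le_sum fun j _ => mul_le_mul_of_nonneg_left ?_ (hw j)
        have := card_mul_sum_erase_le hφ k j
        rw [div_mul_eq_mul_div, le_div_iff₀ hN]
        linarith
    _ = _ := by rw [← sum_mul]; ring

theorem add_rpow_sub_one_le {a b q : ℝ} (ha : 0 ≤ a) (hb : 0 ≤ b) (hq : 1 ≤ q) :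
    (a + b) ^ (q - 1) ≤ (1 + q) ^ (q - 1) * a ^ (q - 1) + 3 * b ^ (q - 1) := by
  have hq0 : 0 < q := by linarith
  have hr : 0 ≤ q - 1 := by linarith
  have h1 : 0 ≤ (1 + q) ^ (q - 1) * a ^ (q - 1) := by positivity
  have h2 : 0 ≤ b ^ (q - 1) := by positivity
  rcases le_total (q * a) b with h | h
  · have hab : a + b ≤ Real.exp (1 / q) * b := by
      have e1 : a ≤ 1 / q * b := by
        rw [one_div, inv_mul_eq_div, le_div_iff₀ hq0]; linarith
      have := mul_le_mul_of_nonneg_right (Real.add_one_le_exp (1 / q)) hb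
      linarith
    have h3 := Real.rpow_le_rpow (by positivity) hab hr
    rw [Real.mul_rpow (Real.exp_pos _).le hb, ← Real.exp_mul] at h3
    have h4 : Real.exp (1 / q * (q - 1)) ≤ 3 := by
      refine le_trans (Real.exp_le_exp.2 ?_) Real.exp_one_lt_three.le
      rw [one_div, inv_mul_eq_div, div_le_one hq0]
      linarith
    have := mul_le_mul_of_nonneg_right h4 h2
    linarith
  · have hab : a + b ≤ (1 + q) * a := by linarith
    have h3 := Real.rpow_le_rpow (by positivity) hab hr
    rw [Real.mul_rpow (by positivity) ha] at h3
    linarith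

/-- A Rosenthal-type inequality for sums over a uniformly random `k`-element subset. -/
theorem sum_powersetCard_rpow_le [Nonempty ι] {a : ι → ℝ} (ha : ∀ i, 0 ≤ a i) {q : ℝ}
    (hq : 1 ≤ q) (k : ℕ) :
    ∑ S ∈ powersetCard k univ, (∑ j ∈ S, a j) ^ q ≤
      ((Fintype.card ι).choose k : ℝ) * ((1 + q) ^ q * (k / Fintype.card ι) * ∑ j, a j ^ q +
        (3 * (k / Fintype.card ι) * ∑ j, a j) ^ q) := by
  have hsum (S : Finset ι) : 0 ≤ ∑ j ∈ S, a j := sum_nonneg fun j _ => ha j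
  have hP : ((powersetCard k (univ : Finset ι)).card : ℝ) = (Fintype.card ι).choose k := by
    rw [card_powersetCard, card_univ]
  have h1 := sum_sum_mul_erase_le (φ := fun _ : Finset ι => (1 : ℝ)) (fun _ _ _ => le_rfl) k
    (w := fun j => a j ^ q) (fun j => Real.rpow_nonneg (ha j) q)
  have h2 := sum_sum_mul_erase_le (φ := fun S : Finset ι => (∑ j ∈ S, a j) ^ (q - 1))
    (fun S T hST => Real.rpow_le_rpow (hsum S)
      (sum_le_sum_of_subset_of_nonneg hST fun j _ _ => ha j) (by linarith)) k ha
  simp only [mul_one, sum_const, nsmul_eq_mul, hP] at h1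
  have h3 : ∑ S ∈ powersetCard k univ, (∑ j ∈ S, a j) ^ q ≤
      (1 + q) ^ (q - 1) * ∑ S ∈ powersetCard k univ, ∑ j ∈ S, a j ^ q +
        3 * ∑ S ∈ powersetCard k univ, ∑ j ∈ S, a j * (∑ i ∈ S.erase j, a i) ^ (q - 1) := by
    rw [mul_sum, mul_sum, ← sum_add_distrib]
    refine sum_le_sum fun S _ => ?_
    rw [rpow_eq_self_mul_rpow_sub_one (hsum S) hq, mul_sum, mul_sum, sum_mul,
      ← sum_add_distrib]
    refine sum_le_sum fun j hj => ?_
    have := mul_le_mul_of_nonneg_left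
      (add_rpow_sub_one_le (ha j) (hsum (S.erase j)) hq) (ha j)
    rw [add_sum_erase S a hj] at this
    rw [rpow_eq_self_mul_rpow_sub_one (ha j) hq]
    linarith
  have h4 := sum_rpow_le_of_le_sum_mul_rpow (powersetCard k univ) (A := fun _ => 1)
    (B := fun S => ∑ j ∈ S, a j) (q := q) (K := 3 * (k / Fintype.card ι) * ∑ j, a j)
    (c := (1 + q) ^ (q - 1) * (k / Fintype.card ι * (∑ j, a j ^ q) *
      (Fintype.card ι).choose k))
    (fun _ _ => zero_le_one) (fun S _ => hsum S) hq
    (mul_nonneg (by positivity) (hsum univ)) (by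
      have := mul_le_mul_of_nonneg_left h1 (show 0 ≤ (1 + q) ^ (q - 1) by positivity)
      simp only [one_mul]
      linarith)
  simp only [Real.one_rpow, sum_const, nsmul_eq_mul, hP, mul_one] at h4
  have h5 : q * (1 + q) ^ (q - 1) ≤ (1 + q) ^ q := by
    rw [rpow_eq_self_mul_rpow_sub_one (b := 1 + q) (by linarith) hq]
    exact mul_le_mul_of_nonneg_right (by linarith) (by positivity)
  have h6 : 0 ≤ k / Fintype.card ι * (∑ j, a j ^ q) * ((Fintype.card ι).choose k : ℝ) := by
    have : 0 ≤ ∑ j, a j ^ q := sum_nonneg fun j _ => Real.rpow_nonneg (ha j) q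
    positivity
  linarith [mul_le_mul_of_nonneg_right h5 h6]

end Sampling

/-! ### Averaging operators on the hypercube -/

section Cube

variable {n : ℕ}

/-- Flip the coordinate with index `m` (the identity when there is no such coordinate). -/
def flipAt (m : ℕ) (ε : Fin n → Bool) : Fin n → Bool :=
  fun j => if (j : ℕ) = m then !ε j else ε j

theorem flipAt_involutive (m : ℕ) : Function.Involutive (flipAt m : (Fin n → Bool) → _) := by
  intro ε
  ext j
  by_cases h : (j : ℕ) = m <;> simp [flipAt, h]

theorem flipAt_val (j : Fin n) (ε : Fin n → Bool) :
    flipAt j ε = Function.update ε j (!ε j) := by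
  ext i
  by_cases h : i = j
  · subst h; simp [flipAt]
  · simp [flipAt, h, Fin.val_inj]

theorem condAvg_flipAt (T : Finset (Fin n)) (g : (Fin n → Bool) → ℝ) (m : ℕ)
    (ε : Fin n → Bool) :
    condAvg T g (flipAt m ε) = condAvg T (fun ε => g (flipAt m ε)) ε := by
  unfold condAvg
  rw [← (flipAt_involutive m).bijective.sum_comp]
  congr 1
  refine sum_congr rfl fun δ _ => congrArg g ?_
  ext j
  by_cases hj : j ∈ T <;> by_cases h : (j : ℕ) = m <;> simp [flipAt, hj, h]

theorem condAvg_flipAt_of_mem {T : Finset (Fin n)} (g : (Fin n → Bool) → ℝ) {m : ℕ}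
    (hm : ∀ j : Fin n, (j : ℕ) = m → j ∈ T) (ε : Fin n → Bool) :
    condAvg T g (flipAt m ε) = condAvg T g ε := by
  unfold condAvg
  congr 1
  refine sum_congr rfl fun δ _ => congrArg g ?_
  ext j
  by_cases h : (j : ℕ) = m
  · simp [hm j h]
  · simp [flipAt, h]

theorem condAvg_neg (T : Finset (Fin n)) (g : (Fin n → Bool) → ℝ) (ε : Fin n → Bool) :
    condAvg T (fun ε => -g ε) ε = -condAvg T g ε := by
  simp [condAvg, sum_neg_distrib, neg_div]

theorem condAvg_sub (T : Finset (Fin n)) (f g : (Fin n → Bool) → ℝ) (ε : Fin n → Bool) :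
    condAvg T (fun ε => f ε - g ε) ε = condAvg T f ε - condAvg T g ε := by
  simp [condAvg, sum_sub_distrib, sub_div]

theorem condAvg_sum {α : Type*} (s : Finset α) (T : Finset (Fin n))
    (g : α → (Fin n → Bool) → ℝ) (ε : Fin n → Bool) :
    condAvg T (fun ε => ∑ i ∈ s, g i ε) ε = ∑ i ∈ s, condAvg T (g i) ε := by
  simp only [condAvg]
  rw [sum_comm, sum_div]

/-- Jensen's inequality for the averaging operators. -/
theorem map_condAvg_le {s : Set ℝ} {φ : ℝ → ℝ} (hφ : ConvexOn ℝ s φ) (T : Finset (Fin n))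
    {g : (Fin n → Bool) → ℝ} (hg : ∀ ε, g ε ∈ s) (ε : Fin n → Bool) :
    φ (condAvg T g ε) ≤ condAvg T (fun ε => φ (g ε)) ε := by
  have := hφ.map_sum_le (t := univ) (w := fun _ : Fin n → Bool => (1 / 2 ^ n : ℝ))
    (p := fun δ => g (fun j => if j ∈ T then δ j else ε j)) (fun _ _ => by positivity)
    (by simp) (fun _ _ => hg _)
  simpa [condAvg, ← mul_sum, div_eq_inv_mul] using this

theorem sq_condAvg_le (T : Finset (Fin n)) (g : (Fin n → Bool) → ℝ) (ε : Fin n → Bool) :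
    condAvg T g ε ^ 2 ≤ condAvg T (fun ε => g ε ^ 2) ε :=
  map_condAvg_le (φ := fun x => x ^ 2) (even_two.convexOn_pow) T (fun _ => Set.mem_univ _) ε

theorem sum_sq_condAvg_rpow_le {α : Type*} (s : Finset α) (T : Finset (Fin n))
    (g : α → (Fin n → Bool) → ℝ) {q : ℝ} (hq : 1 ≤ q) (ε : Fin n → Bool) :
    (∑ i ∈ s, condAvg T (g i) ε ^ 2) ^ q ≤ condAvg T (fun ε => (∑ i ∈ s, g i ε ^ 2) ^ q) ε := by
  refine le_trans (Real.rpow_le_rpow (by positivity)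
    (sum_le_sum fun i _ => sq_condAvg_le T (g i) ε) (by linarith)) ?_
  rw [← condAvg_sum]
  exact map_condAvg_le (convexOn_rpow hq) T (g := fun ε => ∑ i ∈ s, g i ε ^ 2)
    (fun _ => Set.mem_Ici.2 (by positivity)) ε

theorem sum_condAvg (T : Finset (Fin n)) (g : (Fin n → Bool) → ℝ) :
    ∑ ε, condAvg T g ε = ∑ ε, g ε := by
  have hinv : Function.Involutive fun x : (Fin n → Bool) × (Fin n → Bool) =>
      ((fun j => if j ∈ T then x.2 j else x.1 j, fun j => if j ∈ T then x.1 j else x.2 j) :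
        (Fin n → Bool) × (Fin n → Bool)) := by
    rintro ⟨ε, δ⟩
    ext j <;> by_cases hj : j ∈ T <;> simp [hj]
  have h := hinv.bijective.sum_comp (fun x => g x.1)
  rw [Fintype.sum_prod_type, Fintype.sum_prod_type] at h
  simp only [condAvg]
  rw [← sum_div, h]
  simp [← mul_sum]

theorem IsSymmDiff.condAvg {d : ℕ → (Fin n → Bool) → ℝ} (hd : IsSymmDiff flipAt d)
    (T : Finset (Fin n)) : IsSymmDiff flipAt fun m => condAvg T (d m) where
  involutive := flipAt_involutive
  apply_self m ε := by rw [condAvg_flipAt]; simp only [hd.apply_self, condAvg_neg]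
  apply_of_lt i m h ε := by rw [condAvg_flipAt]; simp only [hd.apply_of_lt i m h]

theorem IsSymmDiff.condAvg_eq_zero {d : ℕ → (Fin n → Bool) → ℝ} (hd : IsSymmDiff flipAt d)
    {T : Finset (Fin n)} {j : Fin n} (hj : j ∈ T) (ε : Fin n → Bool) :
    _root_.condAvg T (d j) ε = 0 := by
  have h1 := (hd.condAvg T).apply_self j ε
  have h2 := condAvg_flipAt_of_mem (d j) (m := j) (T := T) (fun i hi => Fin.ext hi ▸ hj) ε
  linarith

/-- The Doob martingale of `h`: average over the coordinates with index at least `m`. -/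
noncomputable def doob (h : (Fin n → Bool) → ℝ) (m : ℕ) : (Fin n → Bool) → ℝ :=
  condAvg {j | m ≤ (j : ℕ)} h

theorem doob_flipAt (h : (Fin n → Bool) → ℝ) {i m : ℕ} (him : i ≤ m) (ε : Fin n → Bool) :
    doob h i (flipAt m ε) = doob h i ε :=
  condAvg_flipAt_of_mem h (fun j hj => by simpa [hj] using him) ε

theorem doob_succ_add_flipAt (h : (Fin n → Bool) → ℝ) (m : ℕ) (ε : Fin n → Bool) :
    doob h (m + 1) ε + doob h (m + 1) (flipAt m ε) = 2 * doob h m ε := by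
  have key : ∑ δ : Fin n → Bool, (h (fun j : Fin n => if m + 1 ≤ (j : ℕ) then δ j else ε j) +
      h (fun j : Fin n => if m + 1 ≤ (j : ℕ) then δ j else flipAt m ε j)) =
      ∑ δ : Fin n → Bool, (h (fun j : Fin n => if m ≤ (j : ℕ) then δ j else ε j) +
        h (fun j : Fin n => if m ≤ (j : ℕ) then flipAt m δ j else ε j)) := by
    refine sum_congr rfl fun δ _ => ?_
    have aux (δ ε : Fin n → Bool) (hδ : ∀ j : Fin n, (j : ℕ) = m → δ j = ε j) :
        (fun j : Fin n => if m + 1 ≤ (j : ℕ) then δ j else ε j) =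
          fun j : Fin n => if m ≤ (j : ℕ) then δ j else ε j := by
      ext j
      rcases lt_trichotomy (j : ℕ) m with hj | hj | hj
      · simp [hj.not_ge, show ¬ m + 1 ≤ (j : ℕ) by omega]
      · simp [hj, hδ j hj]
      · simp [hj.le, show m + 1 ≤ (j : ℕ) by omega]
    have e1 (δ : Fin n → Bool) : (fun j : Fin n => if m + 1 ≤ (j : ℕ) then δ j else ε j) =
        fun j : Fin n => if m + 1 ≤ (j : ℕ) then flipAt m δ j else ε j := by
      ext j
      by_cases hj : m + 1 ≤ (j : ℕ)
      · simp [hj, flipAt, show (j : ℕ) ≠ m by omega]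
      · simp [hj]
    have e2 (δ : Fin n → Bool) : (fun j : Fin n => if m ≤ (j : ℕ) then δ j else flipAt m ε j) =
        fun j : Fin n => if m ≤ (j : ℕ) then δ j else ε j := by
      ext j
      by_cases hj : m ≤ (j : ℕ)
      · simp [hj]
      · simp [hj, flipAt, show (j : ℕ) ≠ m by omega]
    have e3 (δ : Fin n → Bool) :
        (fun j : Fin n => if m + 1 ≤ (j : ℕ) then δ j else flipAt m ε j) =
        fun j : Fin n => if m + 1 ≤ (j : ℕ) then flipAt m δ j else flipAt m ε j := by
      ext j
      by_cases hj : m + 1 ≤ (j : ℕ)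
      · simp [hj, flipAt, show (j : ℕ) ≠ m by omega]
      · simp [hj]
    by_cases hδ : ∀ j : Fin n, (j : ℕ) = m → δ j = ε j
    · rw [aux δ ε hδ, e3, aux (flipAt m δ) (flipAt m ε), e2]
      intro j hj
      simp [flipAt, hj, hδ j hj]
    · push Not at hδ
      obtain ⟨i, hi, hne⟩ := hδ
      have hij (j : Fin n) (hj : (j : ℕ) = m) : δ j = !ε j := by
        have : j = i := Fin.ext (hj.trans hi.symm)
        subst this
        exact Bool.eq_not_of_ne hne
      rw [e1, aux (flipAt m δ) ε, aux δ (flipAt m ε), e2, add_comm]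
      · intro j hj
        simp [flipAt, hj, hij j hj]
      · intro j hj
        simp [flipAt, hj, hij j hj]
  have e := (flipAt_involutive m).bijective.sum_comp
    (fun δ : Fin n → Bool => h (fun j : Fin n => if m ≤ (j : ℕ) then δ j else ε j))
  rw [sum_add_distrib, sum_add_distrib, e] at key
  simp only [doob, condAvg, mem_filter, mem_univ, true_and]
  rw [← add_div, key]
  ring

/-- The increments of the Doob martingale. -/
noncomputable def doobDiff (h : (Fin n → Bool) → ℝ) (m : ℕ) : (Fin n → Bool) → ℝ :=
  fun ε => doob h (m + 1) ε - doob h m ε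

theorem isSymmDiff_doobDiff (h : (Fin n → Bool) → ℝ) : IsSymmDiff flipAt (doobDiff h) where
  involutive := flipAt_involutive
  apply_self m ε := by
    have := doob_succ_add_flipAt h m ε
    simp only [doobDiff, doob_flipAt h le_rfl]
    linarith
  apply_of_lt i m him ε := by
    simp only [doobDiff, doob_flipAt h him.le, doob_flipAt h (Nat.succ_le_of_lt him)]

theorem sum_doobDiff {h : (Fin n → Bool) → ℝ} (h0 : ∑ ε, h ε = 0) (ε : Fin n → Bool) :
    ∑ i ∈ range n, doobDiff h i ε = h ε := by
  have h1 : doob h n ε = h ε := by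
    have (j : Fin n) : ¬ n ≤ (j : ℕ) := j.2.not_ge
    simp [doob, condAvg, this]
  have h2 : doob h 0 ε = 0 := by simp [doob, condAvg, h0]
  simp only [doobDiff]
  rw [sum_range_sub (fun i => doob h i ε), h1, h2, sub_zero]

theorem sum_doobDiff_rpow_le (h : (Fin n → Bool) → ℝ) {q : ℝ} (hq : 1 ≤ q) (j : Fin n) :
    ∑ ε, (doobDiff h j ε ^ 2) ^ q ≤ ∑ ε, (dflip j h ε ^ 2) ^ q := by
  rw [← sum_condAvg {i : Fin n | (j : ℕ) + 1 ≤ i} fun ε => (dflip j h ε ^ 2) ^ q]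
  refine sum_le_sum fun ε _ => ?_
  have h1 : 2 * doobDiff h j ε = condAvg {i : Fin n | (j : ℕ) + 1 ≤ i} (dflip j h) ε := by
    have e1 := doob_succ_add_flipAt h j ε
    have e2 := condAvg_flipAt {i : Fin n | (j : ℕ) + 1 ≤ i} h j ε
    have e3 : dflip j h = fun ε => h ε - h (flipAt j ε) := by
      ext ε
      rw [flipAt_val, dflip]
    rw [e3, condAvg_sub, ← e2]
    simp only [doobDiff]
    simp only [doob] at e1 ⊢
    linarith
  have h2 := sum_sq_condAvg_rpow_le {()} {i : Fin n | (j : ℕ) + 1 ≤ i} (fun _ => dflip j h) hq ε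
  simp only [sum_singleton, ← h1] at h2
  refine le_trans (Real.rpow_le_rpow (sq_nonneg _) ?_ (by linarith)) h2
  nlinarith [sq_nonneg (doobDiff h j ε)]

theorem sum_condAvg_compl_rpow_le {h : (Fin n → Bool) → ℝ} (h0 : ∑ ε, h ε = 0) {q : ℝ}
    (hq : 1 ≤ q) (S : Finset (Fin n)) :
    ∑ ε, (condAvg Sᶜ h ε ^ 2) ^ q ≤
      (10 * q ^ 2) ^ q * ∑ ε, (∑ j ∈ S, doobDiff h j ε ^ 2) ^ q := by
  have hd := isSymmDiff_doobDiff h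
  have h1 := (hd.condAvg Sᶜ).sum_rpow_le_squareFunction hq n
  have e1 (ε : Fin n → Bool) :
      ∑ i ∈ range n, condAvg Sᶜ (doobDiff h i) ε = condAvg Sᶜ h ε := by
    rw [← condAvg_sum]
    simp only [sum_doobDiff h0]
  have e2 (ε : Fin n → Bool) : ∑ i ∈ range n, condAvg Sᶜ (doobDiff h i) ε ^ 2 =
      ∑ j ∈ S, condAvg Sᶜ (doobDiff h j) ε ^ 2 := by
    rw [sum_range fun i => condAvg Sᶜ (doobDiff h i) ε ^ 2]
    refine (sum_subset (subset_univ S) fun j _ hj => ?_).symm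
    rw [hd.condAvg_eq_zero (mem_compl.2 hj)]
    norm_num
  simp only [e1, e2] at h1
  refine h1.trans (mul_le_mul_of_nonneg_left ?_ (by positivity))
  rw [← sum_condAvg Sᶜ fun ε => (∑ j ∈ S, doobDiff h j ε ^ 2) ^ q]
  exact sum_le_sum fun ε _ => sum_sq_condAvg_rpow_le S Sᶜ (fun j => doobDiff h j) hq ε

theorem sum_powersetCard_condAvg_rpow_le (hn : 0 < n) {h : (Fin n → Bool) → ℝ}
    (h0 : ∑ ε, h ε = 0) {q : ℝ} (hq : 1 ≤ q) (k : ℕ) :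
    ∑ S ∈ powersetCard k univ, ∑ ε, (condAvg Sᶜ h ε ^ 2) ^ q ≤
      (10 * q ^ 2) ^ q * (n.choose k * ((1 + q) ^ q * (k / n) *
        ∑ j, ∑ ε, (dflip j h ε ^ 2) ^ q +
          (3 * (k / n)) ^ q * (q ^ q * ∑ ε, (h ε ^ 2) ^ q))) := by
  have : Nonempty (Fin n) := ⟨⟨0, hn⟩⟩
  refine (sum_le_sum fun S _ => sum_condAvg_compl_rpow_le h0 hq S).trans ?_
  rw [← mul_sum, sum_comm]
  refine mul_le_mul_of_nonneg_left ?_ (by positivity)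
  have h1 (ε : Fin n → Bool) := sum_powersetCard_rpow_le
    (a := fun j : Fin n => doobDiff h j ε ^ 2) (fun _ => sq_nonneg _) hq k
  simp only [Fintype.card_fin] at h1
  refine (sum_le_sum fun ε _ => h1 ε).trans ?_
  rw [← mul_sum, sum_add_distrib, ← mul_sum, sum_comm]
  refine mul_le_mul_of_nonneg_left (add_le_add ?_ ?_) (by positivity)
  · exact mul_le_mul_of_nonneg_left (sum_le_sum fun j _ => sum_doobDiff_rpow_le h hq j)
      (by positivity)
  · have h2 := (isSymmDiff_doobDiff h).sum_squareFunction_rpow_le hq n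
    simp only [sum_doobDiff h0] at h2
    have e (ε : Fin n → Bool) : (3 * (k / n) * ∑ j : Fin n, doobDiff h j ε ^ 2) ^ q =
        (3 * (k / n : ℝ)) ^ q * (∑ i ∈ range n, doobDiff h i ε ^ 2) ^ q := by
      rw [Real.mul_rpow (by positivity) (by positivity),
        sum_range fun i => doobDiff h i ε ^ 2]
    simp only [e]
    rw [← mul_sum]
    exact mul_le_mul_of_nonneg_left h2 (by positivity)

end Cube

/-! ### The main inequality -/

theorem sq_rpow_half (x p : ℝ) : (x ^ 2) ^ (p / 2) = |x| ^ p := by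
  rw [← sq_abs, ← Real.rpow_natCast, ← Real.rpow_mul (abs_nonneg x)]
  congr 1
  push_cast
  ring

theorem pnorm_nonneg {n : ℕ} (p : ℝ) (h : (Fin n → Bool) → ℝ) : 0 ≤ pnorm p h :=
  Real.rpow_nonneg (div_nonneg (sum_nonneg fun _ _ => by positivity) (by positivity)) _

theorem pnorm_rpow {n : ℕ} {p : ℝ} (hp : 0 < p) (h : (Fin n → Bool) → ℝ) :
    pnorm p h ^ p = (∑ ε, (h ε ^ 2) ^ (p / 2)) / 2 ^ n := by
  simp only [sq_rpow_half]
  rw [pnorm, ← Real.rpow_mul (div_nonneg (sum_nonneg fun _ _ => by positivity)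
    (by positivity)), one_div_mul_cancel hp.ne', Real.rpow_one]

theorem rpow_half_rpow_one_div {x p : ℝ} (hx : 0 ≤ x) (hp : 0 < p) :
    (x ^ (p / 2)) ^ (1 / p) = √x := by
  rw [← Real.rpow_mul hx, Real.sqrt_eq_rpow]
  congr 1
  field_simp

theorem average_pnorm_condAvg_rpow_le {n k : ℕ} (hn : 0 < n) (hkn : k ≤ n) {p : ℝ} (hp : 2 ≤ p)
    {h : (Fin n → Bool) → ℝ} (h0 : ∑ ε, h ε = 0) :
    (∑ S ∈ powersetCard k (univ : Finset (Fin n)), pnorm p (condAvg Sᶜ h) ^ p) / (n.choose k) ≤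
      (4 * p ^ 3) ^ (p / 2) * ((k / n) * ∑ j, pnorm p (dflip j h) ^ p) +
        (4 * p ^ 3 * (k / n)) ^ (p / 2) * pnorm p h ^ p := by
  have hp0 : 0 < p := by linarith
  have hch : (0 : ℝ) < n.choose k := by exact_mod_cast Nat.choose_pos hkn
  have hmain := sum_powersetCard_condAvg_rpow_le hn h0 (q := p / 2) (by linarith) k
  have hx : (0 : ℝ) ≤ k / n := by positivity
  have hX : 0 ≤ ∑ j, ∑ ε, (dflip j h ε ^ 2) ^ (p / 2) := by positivity
  have hY : 0 ≤ ∑ ε, (h ε ^ 2) ^ (p / 2) := by positivity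
  have c1 : (10 * (p / 2) ^ 2) ^ (p / 2) * (1 + p / 2) ^ (p / 2) ≤ (4 * p ^ 3) ^ (p / 2) := by
    rw [← Real.mul_rpow (by positivity) (by positivity)]
    refine Real.rpow_le_rpow (by positivity) ?_ (by positivity)
    nlinarith [mul_le_mul_of_nonneg_left hp (sq_nonneg p), pow_pos hp0 3]
  have c2 : (10 * (p / 2) ^ 2) ^ (p / 2) * ((3 * (k / n)) ^ (p / 2) * (p / 2) ^ (p / 2)) ≤
      (4 * p ^ 3 * (k / n)) ^ (p / 2) := by
    rw [← Real.mul_rpow (by positivity) (by positivity),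
      ← Real.mul_rpow (by positivity) (by positivity)]
    refine Real.rpow_le_rpow (by positivity) ?_ (by positivity)
    nlinarith [mul_nonneg hx (pow_pos hp0 3).le]
  simp only [pnorm_rpow hp0]
  rw [← sum_div, ← sum_div, div_div, div_le_iff₀ (by positivity)]
  refine hmain.trans ?_
  have d1 := mul_le_mul_of_nonneg_right c1
    (show 0 ≤ n.choose k * ((k / n) * ∑ j, ∑ ε, (dflip j h ε ^ 2) ^ (p / 2)) by positivity)
  have d2 := mul_le_mul_of_nonneg_right c2
    (show 0 ≤ n.choose k * ∑ ε, (h ε ^ 2) ^ (p / 2) by positivity)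
  calc _ = _ := by ring
    _ ≤ _ := add_le_add d1 d2
    _ = _ := by field_simp

theorem sqrt_four_mul_cube {p : ℝ} (hp : 0 < p) : √(4 * p ^ 3) = 2 * p ^ (3 / 2 : ℝ) := by
  rw [Real.sqrt_eq_iff_mul_self_eq (by positivity) (by positivity)]
  symm
  calc 2 * p ^ (3 / 2 : ℝ) * (2 * p ^ (3 / 2 : ℝ))
      = 4 * (p ^ (3 / 2 : ℝ) * p ^ (3 / 2 : ℝ)) := by ring
    _ = 4 * p ^ 3 := by
      rw [← Real.rpow_add hp, ← Real.rpow_natCast p 3]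
      norm_num

theorem rpow_three_halves_le_div_sqrt_log {p : ℝ} (hp : 2 ≤ p) :
    p ^ (3 / 2 : ℝ) ≤ p ^ ((5 : ℝ) / 2) / √(Real.log p) := by
  have hp0 : 0 < p := by linarith
  have hlog : 0 < Real.log p := Real.log_pos (by linarith)
  have hlp : Real.log p ≤ p := (Real.log_le_sub_one_of_pos hp0).trans (by linarith)
  rw [le_div_iff₀ (Real.sqrt_pos.2 hlog)]
  calc p ^ (3 / 2 : ℝ) * √(Real.log p) ≤ p ^ (3 / 2 : ℝ) * p := by
        refine mul_le_mul_of_nonneg_left ?_ (by positivity)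
        rw [Real.sqrt_le_left hp0.le]
        nlinarith
    _ = p ^ ((5 : ℝ) / 2) := by
        rw [← Real.rpow_add_one hp0.ne']
        norm_num

theorem rpow_three_halves_le_div_log {p : ℝ} (hp : 2 ≤ p) :
    p ^ (3 / 2 : ℝ) ≤ p ^ (4 : ℝ) / Real.log p := by
  have hp0 : 0 < p := by linarith
  have hlog : 0 < Real.log p := Real.log_pos (by linarith)
  have hlp : Real.log p ≤ p := (Real.log_le_sub_one_of_pos hp0).trans (by linarith)
  rw [le_div_iff₀ hlog]
  calc p ^ (3 / 2 : ℝ) * Real.log p ≤ p ^ (3 / 2 : ℝ) * p :=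
        mul_le_mul_of_nonneg_left hlp (by positivity)
    _ = p ^ (3 / 2 + 1 : ℝ) := (Real.rpow_add_one hp0.ne' _).symm
    _ ≤ p ^ (4 : ℝ) := Real.rpow_le_rpow_of_exponent_le (by linarith) (by norm_num)

/-- **Refined `X_p` inequality for Rademacher chaos** (inequality (1.12)): there is a universal
`C > 0` such that for every `p ∈ [2,∞)`, `n ∈ ℕ`, `k ∈ [n]` and mean-zero `h : {-1,1}^n → ℝ`,
`((1/binom(n,k)) Σ_{|S|=k} ‖E_{[n]∖S} h‖_p^p)^{1/p}
  ≤ C (p^{5/2}/√(log p)) (k/n)^{1/p} (Σ_j ‖∂_j h‖_p^p)^{1/p} + C (p^4/log p) √(k/n) ‖h‖_p`. -/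
theorem refined_xp_inequality_for_rademacher_chaos :
    ∃ C : ℝ, 0 < C ∧ ∀ p : ℝ, 2 ≤ p → ∀ n : ℕ, 0 < n → ∀ k : ℕ, 1 ≤ k → k ≤ n →
      ∀ h : (Fin n → Bool) → ℝ, (∑ ε : Fin n → Bool, h ε) = 0 →
      ((∑ S ∈ powersetCard k (univ : Finset (Fin n)), pnorm p (condAvg Sᶜ h) ^ p) /
          (n.choose k)) ^ (1 / p) ≤
        C * (p ^ ((5 : ℝ) / 2) / Real.sqrt (Real.log p)) * ((k : ℝ) / n) ^ (1 / p) *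
            (∑ j : Fin n, pnorm p (dflip j h) ^ p) ^ (1 / p) +
          C * (p ^ (4 : ℝ) / Real.log p) * Real.sqrt ((k : ℝ) / n) * pnorm p h := by
  refine ⟨2, by norm_num, fun p hp n hn k _ hkn h h0 => ?_⟩
  have hp0 : 0 < p := by linarith
  have hx : (0 : ℝ) ≤ k / n := by positivity
  have hX : 0 ≤ ∑ j, pnorm p (dflip j h) ^ p :=
    sum_nonneg fun j _ => Real.rpow_nonneg (pnorm_nonneg p _) p
  have hY := pnorm_nonneg p h
  have hYp : 0 ≤ pnorm p h ^ p := Real.rpow_nonneg hY p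
  have hL : 0 ≤ ∑ S ∈ powersetCard k (univ : Finset (Fin n)), pnorm p (condAvg Sᶜ h) ^ p :=
    sum_nonneg fun S _ => Real.rpow_nonneg (pnorm_nonneg p _) p
  refine (Real.rpow_le_rpow (div_nonneg hL (Nat.cast_nonneg _))
    (average_pnorm_condAvg_rpow_le hn hkn hp h0) (one_div_pos.2 hp0).le).trans ?_
  have hp1 : 1 / p ≤ 1 := by rw [div_le_one hp0]; linarith
  refine (Real.rpow_add_le_add_rpow
    (mul_nonneg (Real.rpow_nonneg (by positivity) _) (mul_nonneg hx hX))
    (mul_nonneg (Real.rpow_nonneg (by positivity) _) hYp)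
    (one_div_pos.2 hp0).le hp1).trans (add_le_add ?_ ?_)
  · rw [Real.mul_rpow (by positivity) (mul_nonneg hx hX), Real.mul_rpow hx hX,
      rpow_half_rpow_one_div (by positivity) hp0, sqrt_four_mul_cube hp0, ← mul_assoc]
    exact mul_le_mul_of_nonneg_right (mul_le_mul_of_nonneg_right
      (mul_le_mul_of_nonneg_left (rpow_three_halves_le_div_sqrt_log hp) zero_le_two)
      (Real.rpow_nonneg hx _)) (Real.rpow_nonneg hX _)
  · rw [Real.mul_rpow (by positivity) hYp, rpow_half_rpow_one_div (by positivity) hp0,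
      Real.sqrt_mul (by positivity), sqrt_four_mul_cube hp0, ← Real.rpow_mul hY,
      mul_one_div_cancel hp0.ne', Real.rpow_one]
    exact mul_le_mul_of_nonneg_right (mul_le_mul_of_nonneg_right
      (mul_le_mul_of_nonneg_left (rpow_three_halves_le_div_log hp) zero_le_two)
      (Real.sqrt_nonneg _)) hY
end

section
/- For every p ∈ [2, ∞) there exists C = C(p) ∈ (0, ∞) such that for all m, n ∈ ℕ, every k ∈ [n], and every f : ℤ_{8m}^n → ℝ, (1/((16m)^n·binom(n,k))) Σ_{S ⊆ [n], |S|=k} Σ_{ε ∈ {−1,1}^n} Σ_{x ∈ ℤ_{8m}^n} |T_{[n]∖S} f(x + 4m·ε_S) − T_{[n]∖S} f(x)|^p / m^p ≤ C·( (k/n)·(1/(8m)^n) Σ_{j=1}^n Σ_{x ∈ ℤ_{8m}^n} |f(x + e_j) − f(x)|^p + (k/n)^{p/2}·(1/(16m)^n) Σ_{ε ∈ {−1,1}^n} Σ_{x ∈ ℤ_{8m}^n} |f(x + ε) − f(x)|^p ). -/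
open Finset

/-- The smoothing operator `T_S f (x) = 2^{-n} Σ_{δ ∈ {-1,1}^n} f(x + 2δ_S)` on the
discrete torus `ℤ_{8m}^n`. -/
noncomputable def smoothT {m n : ℕ} [NeZero (8 * m)] (S : Finset (Fin n))
    (f : (Fin n → ZMod (8 * m)) → ℝ) : (Fin n → ZMod (8 * m)) → ℝ :=
  fun x => (∑ δ : Fin n → Bool,
    f (x + fun j => if j ∈ S then 2 * (if δ j then (1 : ZMod (8 * m)) else -1) else 0)) / 2 ^ n


open scoped BigOperators

section Scalar

lemma abs_add_rpow_add_abs_sub_rpow_le {p : ℝ} (hp : 2 ≤ p) (a b : ℝ) :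
    (|a + b| ^ p + |a - b| ^ p) / 2 ≤
      |a| ^ p + (p ^ 2 + (p + 1) ^ p) * (|a| ^ (p - 2) * b ^ 2 + |b| ^ p) := by
  have hp0 : 0 < p := by linarith
  rcases le_or_gt |a| (p * |b|) with hab | hab
  · have hbound : ∀ c : ℝ, |c| ≤ |a| + |b| → |c| ^ p ≤ (p + 1) ^ p * |b| ^ p := fun c hc => by
      rw [← Real.mul_rpow (by positivity) (abs_nonneg b)]
      exact Real.rpow_le_rpow (abs_nonneg c) (by linarith) hp0.le
    have h₁ := hbound _ (abs_add_le a b)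
    have h₂ := hbound _ (abs_sub a b)
    have h₃ : 0 ≤ |a| ^ p := by positivity
    have h₄ : 0 ≤ p ^ 2 * |b| ^ p := by positivity
    have h₅ : 0 ≤ (p ^ 2 + (p + 1) ^ p) * (|a| ^ (p - 2) * b ^ 2) := by positivity
    linarith
  · have ha : 0 < |a| := lt_of_le_of_lt (by positivity) hab
    have ha' : a ≠ 0 := abs_pos.mp ha
    set t := b / a with ht
    have hb : b = a * t := by rw [ht]; field_simp
    have hpt : p * |t| < 1 := by
      rw [ht, abs_div, mul_div_assoc', div_lt_one ha]; exact hab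
    have hpt' : |p * t| ≤ 1 := by rw [abs_mul, abs_of_pos hp0]; exact hpt.le
    have hone : ∀ s : ℝ, |p * s| ≤ 1 → |1 + s| ^ p ≤ 1 + p * s + (p * s) ^ 2 := fun s hs => by
      have hs' : |s| ≤ 1 := by
        rw [abs_mul, abs_of_pos hp0] at hs
        nlinarith [abs_nonneg s]
      have hs0 : 0 ≤ 1 + s := by linarith [(abs_le.mp hs').1]
      have hexp : (1 + s) ^ p ≤ Real.exp (p * s) := by
        rw [mul_comm p s, Real.exp_mul]
        exact Real.rpow_le_rpow hs0 (by linarith [Real.add_one_le_exp s]) hp0.le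
      rw [abs_of_nonneg hs0]
      linarith [(abs_le.mp (Real.abs_exp_sub_one_sub_id_le hs)).2]
    have h₁ := hone t hpt'
    have h₂ := hone (-t) (by rwa [mul_neg, abs_neg])
    have e₁ : |a + b| ^ p = |a| ^ p * |1 + t| ^ p := by
      rw [← Real.mul_rpow (abs_nonneg _) (abs_nonneg _), ← abs_mul, hb]; ring_nf
    have e₂ : |a - b| ^ p = |a| ^ p * |1 + -t| ^ p := by
      rw [← Real.mul_rpow (abs_nonneg _) (abs_nonneg _), ← abs_mul, hb]; ring_nf
    have e₃ : |a| ^ (p - 2) * b ^ 2 = |a| ^ p * t ^ 2 := by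
      rw [hb, mul_pow, ← sq_abs a, ← mul_assoc, ← Real.rpow_natCast, ← Real.rpow_add ha]
      norm_num
    have hpos : 0 ≤ |a| ^ p := by positivity
    have h₃ : (|a + b| ^ p + |a - b| ^ p) / 2 ≤ |a| ^ p + p ^ 2 * (|a| ^ p * t ^ 2) := by
      rw [e₁, e₂]
      nlinarith
    rw [← e₃] at h₃
    have h₄ : 0 ≤ (p + 1) ^ p * (|a| ^ (p - 2) * b ^ 2) := by positivity
    have h₅ : 0 ≤ (p ^ 2 + (p + 1) ^ p) * |b| ^ p := by positivity
    linarith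

lemma rpow_sub_two_mul_le {p u w : ℝ} (hp : 2 ≤ p) (hu : 0 ≤ u) (hw : 0 ≤ w) :
    u ^ (p - 2) * w ≤ u ^ p + w ^ (p / 2) := by
  rcases le_total w (u ^ 2) with h | h
  · have : u ^ (p - 2) * u ^ 2 = u ^ p := by
      rw [← Real.rpow_natCast, ← Real.rpow_add_of_nonneg hu (by linarith) (by norm_num)]
      norm_num
    have h₁ : u ^ (p - 2) * w ≤ u ^ (p - 2) * u ^ 2 := by gcongr
    have h₂ : 0 ≤ w ^ (p / 2) := by positivity
    linarith
  · have h₁ : u ^ (p - 2) ≤ w ^ (p / 2 - 1) := by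
      calc u ^ (p - 2) = (u ^ 2) ^ (p / 2 - 1) := by
            rw [← Real.rpow_natCast, ← Real.rpow_mul hu]; congr 1; push_cast; ring
        _ ≤ w ^ (p / 2 - 1) := Real.rpow_le_rpow (by positivity) h (by linarith)
    have h₂ : w ^ (p / 2 - 1) * w = w ^ (p / 2) := by
      nth_rewrite 2 [← Real.rpow_one w]
      rw [← Real.rpow_add_of_nonneg hw (by linarith) (by norm_num)]
      norm_num
    have h₃ : u ^ (p - 2) * w ≤ w ^ (p / 2 - 1) * w := by gcongr
    have h₄ : 0 ≤ u ^ p := by positivity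
    linarith

lemma abs_expect_rpow_le {α : Type*} {s : Finset α} {p : ℝ} (hp : 1 ≤ p) (f : α → ℝ) :
    |𝔼 i ∈ s, f i| ^ p ≤ 𝔼 i ∈ s, |f i| ^ p := by
  rcases s.eq_empty_or_nonempty with rfl | hs
  · simp [Real.zero_rpow (by linarith : p ≠ 0)]
  have hc : (0 : ℝ) < #s := by exact_mod_cast hs.card_pos
  refine (Real.rpow_le_rpow (abs_nonneg _) (abs_expect_le s f) (by linarith)).trans ?_
  have := Real.rpow_arith_mean_le_arith_mean_rpow s (fun _ => (#s : ℝ)⁻¹) (fun i => |f i|)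
    (fun _ _ => by positivity) (by simp [hc.ne']) (fun _ _ => abs_nonneg _) hp
  simpa only [expect_eq_sum_div_card, div_eq_inv_mul, mul_sum] using this

end Scalar

section Cube

variable {ι : Type*} [DecidableEq ι]

/-- The sign `±1` encoded by a Boolean. -/
def boolSign (b : Bool) : ℝ := if b then 1 else -1

lemma boolSign_mul_self (b : Bool) : boolSign b * boolSign b = 1 := by
  cases b <;> simp [boolSign]

lemma piecewise_update_right_of_notMem {S : Finset ι} {j : ι} (hj : j ∉ S) (ε δ : ι → Bool)
    (b : Bool) :
    S.piecewise ε (Function.update δ j b) = Function.update (S.piecewise ε δ) j b := by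
  rw [update_piecewise_of_notMem _ _ _ hj]

variable [Fintype ι]

lemma expect_eq_expect_update (j : ι) (g : (ι → Bool) → ℝ) :
    𝔼 δ, g δ = 𝔼 δ, (g (Function.update δ j true) + g (Function.update δ j false)) / 2 := by
  have hinv : Function.Involutive fun δ : ι → Bool => Function.update δ j (!δ j) := by
    intro δ; simp
  have hflip : 𝔼 δ, g (Function.update δ j (!δ j)) = 𝔼 δ, g δ :=
    Fintype.expect_equiv hinv.toPerm _ _ fun _ => rfl
  have hpt : ∀ δ : ι → Bool, (g (Function.update δ j true) + g (Function.update δ j false)) / 2 =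
      (g δ + g (Function.update δ j (!δ j))) / 2 := by
    intro δ
    cases h : δ j
    · rw [show Function.update δ j false = δ by rw [← h, Function.update_eq_self], Bool.not_false,
        add_comm]
    · rw [show Function.update δ j true = δ by rw [← h, Function.update_eq_self], Bool.not_true]
  simp_rw [hpt]
  rw [← expect_div, expect_add_distrib, hflip]
  ring

/-- The conditional expectation of `h` given the coordinates in `S`, on the discrete cube. -/
noncomputable def cubeCondExp (S : Finset ι) (h : (ι → Bool) → ℝ) (ε : ι → Bool) : ℝ :=
  𝔼 δ, h (S.piecewise ε δ)

/-- The coefficient of the `j`-th coordinate of `h`: half the difference of the values of `h`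
at the two vertices of an edge in direction `j`. -/
noncomputable def cubeDeriv (j : ι) (h : (ι → Bool) → ℝ) (ε : ι → Bool) : ℝ :=
  (h (Function.update ε j true) - h (Function.update ε j false)) / 2

lemma expect_cubeCondExp (S : Finset ι) (h : (ι → Bool) → ℝ) :
    𝔼 ε, cubeCondExp S h ε = 𝔼 ε, h ε := by
  have hinv : Function.Involutive fun q : (ι → Bool) × (ι → Bool) =>
      (S.piecewise q.1 q.2, S.piecewise q.2 q.1) := by
    intro q
    ext i <;> by_cases hi : i ∈ S <;> simp [hi]
  calc 𝔼 ε, cubeCondExp S h ε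
      = 𝔼 q : (ι → Bool) × (ι → Bool), h (S.piecewise q.1 q.2) := by
        rw [← univ_product_univ, expect_product]; rfl
    _ = 𝔼 q : (ι → Bool) × (ι → Bool), h q.1 :=
        Fintype.expect_equiv hinv.toPerm _ _ fun _ => rfl
    _ = 𝔼 ε, h ε := by
        rw [← univ_product_univ, expect_product]
        simp

lemma expect_abs_cubeCondExp_rpow_le {p : ℝ} (hp : 1 ≤ p) (S : Finset ι) (h : (ι → Bool) → ℝ) :
    𝔼 ε, |cubeCondExp S h ε| ^ p ≤ 𝔼 ε, |h ε| ^ p := by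
  rw [← expect_cubeCondExp S fun ε => |h ε| ^ p]
  exact expect_le_expect fun ε _ => abs_expect_rpow_le hp _

lemma cubeCondExp_update_of_notMem {S : Finset ι} {j : ι} (hj : j ∉ S) (h : (ι → Bool) → ℝ)
    (ε : ι → Bool) (b : Bool) :
    cubeCondExp S h (Function.update ε j b) = cubeCondExp S h ε := by
  refine expect_congr rfl fun δ _ => congrArg h (funext fun i => ?_)
  by_cases hi : i ∈ S
  · have : i ≠ j := by rintro rfl; exact hj hi
    simp [hi, this]
  · simp [hi]

lemma cubeCondExp_cubeDeriv {S : Finset ι} {j : ι} (hj : j ∉ S) (h : (ι → Bool) → ℝ)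
    (ε : ι → Bool) :
    cubeCondExp S (cubeDeriv j h) ε = 𝔼 δ, boolSign (δ j) * h (S.piecewise ε δ) := by
  rw [expect_eq_expect_update j fun δ => boolSign (δ j) * h (S.piecewise ε δ)]
  refine expect_congr rfl fun δ _ => ?_
  simp only [cubeDeriv, piecewise_update_right_of_notMem hj, Function.update_self, boolSign]
  simp [sub_eq_add_neg]

lemma cubeCondExp_insert {S : Finset ι} {j : ι} (hj : j ∉ S) (h : (ι → Bool) → ℝ)
    (ε : ι → Bool) :
    cubeCondExp (insert j S) h ε =
      cubeCondExp S h ε + boolSign (ε j) * cubeCondExp S (cubeDeriv j h) ε := by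
  simp only [cubeCondExp]
  rw [expect_eq_expect_update j fun δ => h (S.piecewise ε δ), mul_expect, ← expect_add_distrib]
  refine expect_congr rfl fun δ _ => ?_
  rw [piecewise_insert]
  simp only [cubeDeriv, piecewise_update_right_of_notMem hj]
  cases ε j <;> simp [boolSign] <;> ring

lemma expect_boolSign_mul_boolSign (i j : ι) :
    𝔼 δ : ι → Bool, boolSign (δ i) * boolSign (δ j) = if i = j then 1 else 0 := by
  split_ifs with hij
  · subst hij; simp [boolSign_mul_self]
  · rw [expect_eq_expect_update i]
    refine expect_eq_zero fun δ _ => ?_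
    cases h : δ j <;> simp [boolSign, Function.update_of_ne (Ne.symm hij), h]

lemma sum_sq_expect_boolSign_mul_le (J : Finset ι) (g : (ι → Bool) → ℝ) :
    ∑ j ∈ J, (𝔼 δ, boolSign (δ j) * g δ) ^ 2 ≤ 𝔼 δ, g δ ^ 2 := by
  set c : ι → ℝ := fun j => 𝔼 δ, boolSign (δ j) * g δ with hc
  have hcross : 𝔼 δ, g δ * ∑ j ∈ J, c j * boolSign (δ j) = ∑ j ∈ J, c j ^ 2 := by
    simp_rw [mul_sum]
    rw [expect_sum_comm]
    refine sum_congr rfl fun j _ => ?_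
    rw [sq]
    conv_rhs => rw [hc, mul_expect]
    exact expect_congr rfl fun δ _ => by ring
  have hsq : 𝔼 δ : ι → Bool, (∑ j ∈ J, c j * boolSign (δ j)) ^ 2 = ∑ j ∈ J, c j ^ 2 := by
    simp_rw [sq, sum_mul_sum]
    rw [expect_sum_comm]
    refine sum_congr rfl fun i hi => ?_
    rw [expect_sum_comm]
    have : ∀ j ∈ J, 𝔼 δ : ι → Bool, c i * boolSign (δ i) * (c j * boolSign (δ j)) =
        if i = j then c i * c j else 0 := fun j _ => by
      have e : ∀ δ : ι → Bool, c i * boolSign (δ i) * (c j * boolSign (δ j)) =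
        c i * c j * (boolSign (δ i) * boolSign (δ j)) := fun δ => by ring
      simp_rw [e]
      rw [← mul_expect, expect_boolSign_mul_boolSign]
      simp
    rw [sum_congr rfl this]
    simp [hi]
  have hnonneg : 0 ≤ 𝔼 δ, (g δ - ∑ j ∈ J, c j * boolSign (δ j)) ^ 2 :=
    expect_nonneg fun _ _ => sq_nonneg _
  have hexpand : 𝔼 δ, (g δ - ∑ j ∈ J, c j * boolSign (δ j)) ^ 2 =
      𝔼 δ, g δ ^ 2 - 2 * (𝔼 δ, g δ * ∑ j ∈ J, c j * boolSign (δ j)) +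
        𝔼 δ : ι → Bool, (∑ j ∈ J, c j * boolSign (δ j)) ^ 2 := by
    rw [mul_expect, ← expect_sub_distrib, ← expect_add_distrib]
    exact expect_congr rfl fun δ _ => by ring
  rw [hexpand, hcross, hsq] at hnonneg
  linarith

lemma sum_sq_cubeCondExp_cubeDeriv_le (S : Finset ι) (h : (ι → Bool) → ℝ) (ε : ι → Bool) :
    ∑ j ∈ Sᶜ, cubeCondExp S (cubeDeriv j h) ε ^ 2 ≤ cubeCondExp S (fun δ => h δ ^ 2) ε := by
  refine le_trans (le_of_eq ?_) (sum_sq_expect_boolSign_mul_le Sᶜ fun δ => h (S.piecewise ε δ))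
  refine sum_congr rfl fun j hj => ?_
  rw [cubeCondExp_cubeDeriv (by simpa using hj)]

lemma expect_abs_cubeCondExp_insert_rpow_le {p : ℝ} (hp : 2 ≤ p) {S : Finset ι} {j : ι}
    (hj : j ∉ S) (h : (ι → Bool) → ℝ) :
    𝔼 ε, |cubeCondExp (insert j S) h ε| ^ p ≤ 𝔼 ε, |cubeCondExp S h ε| ^ p +
      (p ^ 2 + (p + 1) ^ p) *
        (𝔼 ε, |cubeCondExp S h ε| ^ (p - 2) * cubeCondExp S (cubeDeriv j h) ε ^ 2 +
          𝔼 ε, |cubeDeriv j h ε| ^ p) := by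
  have hd := expect_abs_cubeCondExp_rpow_le (by linarith : 1 ≤ p) S (cubeDeriv j h)
  have hK : 0 ≤ p ^ 2 + (p + 1) ^ p := by positivity
  calc 𝔼 ε, |cubeCondExp (insert j S) h ε| ^ p
      = 𝔼 ε, (|cubeCondExp S h ε + cubeCondExp S (cubeDeriv j h) ε| ^ p +
          |cubeCondExp S h ε - cubeCondExp S (cubeDeriv j h) ε| ^ p) / 2 := by
        rw [expect_eq_expect_update j]
        refine expect_congr rfl fun ε _ => ?_
        simp [cubeCondExp_insert hj, cubeCondExp_update_of_notMem hj, boolSign, sub_eq_add_neg]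
    _ ≤ 𝔼 ε, (|cubeCondExp S h ε| ^ p + (p ^ 2 + (p + 1) ^ p) *
          (|cubeCondExp S h ε| ^ (p - 2) * cubeCondExp S (cubeDeriv j h) ε ^ 2 +
            |cubeCondExp S (cubeDeriv j h) ε| ^ p)) :=
        expect_le_expect fun ε _ => abs_add_rpow_add_abs_sub_rpow_le hp _ _
    _ = 𝔼 ε, |cubeCondExp S h ε| ^ p + (p ^ 2 + (p + 1) ^ p) *
        (𝔼 ε, |cubeCondExp S h ε| ^ (p - 2) * cubeCondExp S (cubeDeriv j h) ε ^ 2 +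
          𝔼 ε, |cubeCondExp S (cubeDeriv j h) ε| ^ p) := by
        rw [expect_add_distrib, ← mul_expect, expect_add_distrib]
    _ ≤ _ := by gcongr

lemma expect_powersetCard_succ {i : ℕ} (hi : i < Fintype.card ι) (Φ : Finset ι → ℝ) :
    𝔼 S ∈ powersetCard (i + 1) univ, Φ S =
      𝔼 S ∈ powersetCard i univ, (∑ j ∈ Sᶜ, Φ (insert j S)) / ((Fintype.card ι : ℝ) - i) := by
  have hsum : ((i : ℝ) + 1) * ∑ S ∈ powersetCard (i + 1) (univ : Finset ι), Φ S =
      ∑ S ∈ powersetCard i (univ : Finset ι), ∑ j ∈ Sᶜ, Φ (insert j S) := by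
    have hconst : ∀ S ∈ powersetCard (i + 1) (univ : Finset ι),
        ((i : ℝ) + 1) * Φ S = ∑ _j ∈ S, Φ S := fun S hS => by
      rw [sum_const, (mem_powersetCard.mp hS).2, nsmul_eq_mul]
      push_cast
      rfl
    rw [mul_sum, sum_congr rfl hconst, sum_sigma', sum_sigma']
    refine sum_bij' (fun q _ => ⟨q.1.erase q.2, q.2⟩) (fun q _ => ⟨insert q.2 q.1, q.2⟩)
      ?_ ?_ ?_ ?_ ?_
    · rintro ⟨S, j⟩ h
      simp only [mem_sigma, mem_powersetCard_univ] at h ⊢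
      simp [card_erase_of_mem h.2, h.1]
    · rintro ⟨S, j⟩ h
      simp only [mem_sigma, mem_powersetCard_univ, mem_compl] at h ⊢
      simp [card_insert_of_notMem h.2, h.1]
    · rintro ⟨S, j⟩ h
      simp only [mem_sigma] at h
      simp [insert_erase h.2]
    · rintro ⟨S, j⟩ h
      simp only [mem_sigma, mem_compl] at h
      simp [erase_insert h.2]
    · rintro ⟨S, j⟩ h
      simp only [mem_sigma] at h
      simp [insert_erase h.2]
  have hchoose : ((Fintype.card ι).choose (i + 1) : ℝ) * (i + 1) =
      (Fintype.card ι).choose i * ((Fintype.card ι : ℝ) - i) := by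
    rw [← Nat.cast_sub hi.le]
    exact_mod_cast Nat.choose_succ_right_eq (Fintype.card ι) i
  have hpos : (0 : ℝ) < (Fintype.card ι : ℝ) - i := sub_pos.mpr (by exact_mod_cast hi)
  have hc₁ : (0 : ℝ) < (Fintype.card ι).choose (i + 1) := by exact_mod_cast Nat.choose_pos hi
  have hc₀ : (0 : ℝ) < (Fintype.card ι).choose i := by exact_mod_cast Nat.choose_pos hi.le
  rw [← expect_div, expect_eq_sum_div_card, expect_eq_sum_div_card, card_powersetCard,
    card_powersetCard, card_univ, ← hsum, div_div, div_eq_div_iff hc₁.ne' (by positivity),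
    ← hchoose]
  ring

lemma sum_expect_abs_cubeCondExp_insert_rpow_le {p : ℝ} (hp : 2 ≤ p) {k : ℕ} (hk : 1 ≤ k)
    (hkn : 2 * k ≤ Fintype.card ι) {S : Finset ι} (hS : #S < k) (h : (ι → Bool) → ℝ) :
    (∑ j ∈ Sᶜ, 𝔼 ε, |cubeCondExp (insert j S) h ε| ^ p) / ((Fintype.card ι : ℝ) - #S) ≤
      𝔼 ε, |cubeCondExp S h ε| ^ p + 2 * (p ^ 2 + (p + 1) ^ p) / k *
        (𝔼 ε, |cubeCondExp S h ε| ^ p +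
          ((k : ℝ) / Fintype.card ι * ∑ j, 𝔼 ε, |cubeDeriv j h ε| ^ p +
            ((k : ℝ) / Fintype.card ι) ^ (p / 2) * 𝔼 ε, |h ε| ^ p)) := by
  set n := Fintype.card ι with hn
  set K := p ^ 2 + (p + 1) ^ p with hK
  set l : ℝ := (k : ℝ) / n with hl
  set U := 𝔼 ε, |cubeCondExp S h ε| ^ p with hU
  set B := ∑ j, 𝔼 ε, |cubeDeriv j h ε| ^ p with hB
  set X := ∑ j ∈ Sᶜ, 𝔼 ε, |cubeCondExp S h ε| ^ (p - 2) * cubeCondExp S (cubeDeriv j h) ε ^ 2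
    with hX
  have hK0 : 0 ≤ K := by positivity
  have hk0 : (0 : ℝ) < k := by exact_mod_cast hk
  have hkn' : 2 * (k : ℝ) ≤ n := by exact_mod_cast hkn
  have hn0 : (0 : ℝ) < n := by linarith
  have hS' : (#S : ℝ) < k := by exact_mod_cast hS
  have hd : 0 < (n : ℝ) - #S := by linarith
  have hl0 : 0 ≤ l := by positivity
  have hB0 : 0 ≤ B := sum_nonneg fun j _ => expect_nonneg fun ε _ => by positivity
  have hX0 : 0 ≤ X := sum_nonneg fun j _ => expect_nonneg fun ε _ => by positivity
  have hsum : ∑ j ∈ Sᶜ, 𝔼 ε, |cubeCondExp (insert j S) h ε| ^ p ≤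
      ((n : ℝ) - #S) * U + K * (X + B) := by
    calc ∑ j ∈ Sᶜ, 𝔼 ε, |cubeCondExp (insert j S) h ε| ^ p
        ≤ ∑ j ∈ Sᶜ, (U + K *
            (𝔼 ε, |cubeCondExp S h ε| ^ (p - 2) * cubeCondExp S (cubeDeriv j h) ε ^ 2 +
              𝔼 ε, |cubeDeriv j h ε| ^ p)) :=
          sum_le_sum fun j hj => expect_abs_cubeCondExp_insert_rpow_le hp (mem_compl.mp hj) h
      _ = ((n : ℝ) - #S) * U + K * (X + ∑ j ∈ Sᶜ, 𝔼 ε, |cubeDeriv j h ε| ^ p) := by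
          rw [sum_add_distrib, sum_const, card_compl, nsmul_eq_mul, Nat.cast_sub (card_le_univ S),
            ← mul_sum, sum_add_distrib]
      _ ≤ _ := by
          gcongr
          exact sum_le_univ_sum_of_nonneg fun j => expect_nonneg fun ε _ => by positivity
  have hXU : l * X ≤ U + l ^ (p / 2) * 𝔼 ε, |h ε| ^ p := by
    have hpt : ∀ ε, l * ∑ j ∈ Sᶜ,
        |cubeCondExp S h ε| ^ (p - 2) * cubeCondExp S (cubeDeriv j h) ε ^ 2 ≤
        |cubeCondExp S h ε| ^ p + l ^ (p / 2) * cubeCondExp S (fun δ => |h δ| ^ p) ε := fun ε => by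
      have hv0 : 0 ≤ cubeCondExp S (fun δ => h δ ^ 2) ε := expect_nonneg fun _ _ => sq_nonneg _
      have hjensen : cubeCondExp S (fun δ => h δ ^ 2) ε ^ (p / 2) ≤
          cubeCondExp S (fun δ => |h δ| ^ p) ε := by
        have : |cubeCondExp S (fun δ => h δ ^ 2) ε| ^ (p / 2) ≤
            𝔼 δ, |h (S.piecewise ε δ) ^ 2| ^ (p / 2) :=
          abs_expect_rpow_le (by linarith) _
        rw [abs_of_nonneg hv0] at this
        refine this.trans_eq (expect_congr rfl fun δ _ => ?_)
        rw [abs_of_nonneg (sq_nonneg _), ← sq_abs, ← Real.rpow_natCast,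
          ← Real.rpow_mul (abs_nonneg _)]
        congr 1
        push_cast
        ring
      rw [← mul_sum]
      calc l * (|cubeCondExp S h ε| ^ (p - 2) *
            ∑ j ∈ Sᶜ, cubeCondExp S (cubeDeriv j h) ε ^ 2)
          ≤ l * (|cubeCondExp S h ε| ^ (p - 2) * cubeCondExp S (fun δ => h δ ^ 2) ε) := by
            gcongr
            exact sum_sq_cubeCondExp_cubeDeriv_le S h ε
        _ = |cubeCondExp S h ε| ^ (p - 2) * (l * cubeCondExp S (fun δ => h δ ^ 2) ε) := by ring
        _ ≤ |cubeCondExp S h ε| ^ p + (l * cubeCondExp S (fun δ => h δ ^ 2) ε) ^ (p / 2) :=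
            rpow_sub_two_mul_le hp (abs_nonneg _) (by positivity)
        _ ≤ _ := by
            rw [Real.mul_rpow hl0 hv0]
            gcongr
    rw [hX, ← expect_sum_comm, mul_expect, hU, ← expect_cubeCondExp S fun δ => |h δ| ^ p,
      mul_expect, ← expect_add_distrib]
    exact expect_le_expect fun ε _ => hpt ε
  have hfrac : K / ((n : ℝ) - #S) ≤ 2 * K / k * l := by
    have : 2 * K / k * l = K / ((n : ℝ) / 2) := by rw [hl]; field_simp
    rw [this]
    exact div_le_div_of_nonneg_left hK0 (by positivity) (by linarith)
  clear_value U B X K l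
  calc (∑ j ∈ Sᶜ, 𝔼 ε, |cubeCondExp (insert j S) h ε| ^ p) / ((n : ℝ) - #S)
      ≤ (((n : ℝ) - #S) * U + K * (X + B)) / ((n : ℝ) - #S) := by gcongr
    _ = U + K / ((n : ℝ) - #S) * (X + B) := by
        rw [add_div, mul_div_cancel_left₀ _ hd.ne', mul_div_right_comm]
    _ ≤ U + 2 * K / k * l * (X + B) := by gcongr
    _ = U + 2 * K / k * (l * X + l * B) := by ring
    _ ≤ U + 2 * K / k * ((U + l ^ (p / 2) * 𝔼 ε, |h ε| ^ p) + l * B) := by gcongr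
    _ = _ := by ring

/-- The `X_p` inequality for mean-zero functions on the discrete cube: averaging a function over
all but `k` randomly chosen coordinates reduces its `p`-th moment. -/
theorem expect_powersetCard_abs_cubeCondExp_rpow_le {p : ℝ} (hp : 2 ≤ p) {k : ℕ} (hk : 1 ≤ k)
    (hkn : k ≤ Fintype.card ι) (h : (ι → Bool) → ℝ) (h0 : 𝔼 ε, h ε = 0) :
    𝔼 S ∈ powersetCard k univ, 𝔼 ε, |cubeCondExp S h ε| ^ p ≤
      (Real.exp (2 * (p ^ 2 + (p + 1) ^ p)) + 2 ^ (p / 2)) *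
        ((k : ℝ) / Fintype.card ι * ∑ j, 𝔼 ε, |cubeDeriv j h ε| ^ p +
          ((k : ℝ) / Fintype.card ι) ^ (p / 2) * 𝔼 ε, |h ε| ^ p) := by
  have hk0 : (0 : ℝ) < k := by exact_mod_cast hk
  have hn0 : (0 : ℝ) < Fintype.card ι := by exact_mod_cast hk.trans hkn
  have hB0 : 0 ≤ ∑ j, 𝔼 ε, |cubeDeriv j h ε| ^ p :=
    sum_nonneg fun j _ => expect_nonneg fun ε _ => by positivity
  have hH0 : 0 ≤ 𝔼 ε, |h ε| ^ p := expect_nonneg fun ε _ => by positivity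
  set Q := (k : ℝ) / Fintype.card ι * ∑ j, 𝔼 ε, |cubeDeriv j h ε| ^ p +
    ((k : ℝ) / Fintype.card ι) ^ (p / 2) * 𝔼 ε, |h ε| ^ p with hQ
  have hQ0 : 0 ≤ Q := by positivity
  set K := p ^ 2 + (p + 1) ^ p with hK
  have hK0 : 0 ≤ K := by positivity
  have hHQ : ((k : ℝ) / Fintype.card ι) ^ (p / 2) * 𝔼 ε, |h ε| ^ p ≤ Q :=
    le_add_of_nonneg_left (by positivity)
  clear_value K Q
  rcases le_or_gt (2 * k) (Fintype.card ι) with hhalf | hhalf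
  · have hgrow : ∀ i ≤ k, 𝔼 S ∈ powersetCard i univ, 𝔼 ε, |cubeCondExp S h ε| ^ p + Q ≤
        (1 + 2 * K / k) ^ i * Q := by
      intro i
      induction i with
      | zero =>
        intro _
        have : ∀ ε, cubeCondExp ∅ h ε = 0 := fun ε => by simpa [cubeCondExp] using h0
        simp [this, Real.zero_rpow (by linarith : p ≠ 0)]
      | succ i ih =>
        intro hi
        rw [expect_powersetCard_succ (by omega)]
        have hstep : 𝔼 S ∈ powersetCard i univ,
            (∑ j ∈ Sᶜ, 𝔼 ε, |cubeCondExp (insert j S) h ε| ^ p) / ((Fintype.card ι : ℝ) - i) ≤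
            𝔼 S ∈ powersetCard i univ, (𝔼 ε, |cubeCondExp S h ε| ^ p + 2 * K / k *
              (𝔼 ε, |cubeCondExp S h ε| ^ p + Q)) := by
          refine expect_le_expect fun S hS => ?_
          have hSi : #S = i := (mem_powersetCard.mp hS).2
          rw [← hSi, hK, hQ]
          exact sum_expect_abs_cubeCondExp_insert_rpow_le hp hk hhalf (by omega) h
        have hne : (powersetCard i (univ : Finset ι)).Nonempty :=
          powersetCard_nonempty.mpr (by rw [card_univ]; omega)
        rw [expect_add_distrib, ← mul_expect, expect_add_distrib, expect_const hne] at hstep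
        have ih' := mul_le_mul_of_nonneg_left (ih (by omega))
          (by positivity : 0 ≤ 1 + 2 * K / (k : ℝ))
        rw [pow_succ]
        linarith
    have hexp : (1 + 2 * K / k) ^ k ≤ Real.exp (2 * K) := by
      calc (1 + 2 * K / k) ^ k ≤ Real.exp (2 * K / k) ^ k := by
            gcongr
            linarith [Real.add_one_le_exp (2 * K / k)]
        _ = Real.exp (2 * K) := by
            rw [← Real.exp_nat_mul]
            congr 1
            field_simp
    have h₁ := hgrow k le_rfl
    have h₂ := mul_le_mul_of_nonneg_right hexp hQ0
    have h₃ : 0 ≤ (2 : ℝ) ^ (p / 2) * Q := by positivity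
    linarith
  · have h₁ : 𝔼 S ∈ powersetCard k univ, 𝔼 ε, |cubeCondExp S h ε| ^ p ≤ 𝔼 ε, |h ε| ^ p :=
      expect_le (powersetCard_nonempty.mpr (by rwa [card_univ]))
        fun S _ => expect_abs_cubeCondExp_rpow_le (by linarith) S h
    have h₂ : 1 ≤ 2 ^ (p / 2) * ((k : ℝ) / Fintype.card ι) ^ (p / 2) := by
      rw [← Real.mul_rpow (by norm_num) (by positivity)]
      refine Real.one_le_rpow ?_ (by linarith)
      rw [mul_div_assoc', le_div_iff₀ hn0, one_mul]
      exact_mod_cast hhalf.le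
    have h₃ := mul_le_mul_of_nonneg_right h₂ hH0
    have h₄ : 0 ≤ Real.exp (2 * K) * Q := by positivity
    have h₅ := mul_le_mul_of_nonneg_left hHQ (by positivity : (0 : ℝ) ≤ 2 ^ (p / 2))
    linarith

end Cube

section Torus

section Translation

variable {G : Type*} [AddCommGroup G] [Fintype G]

lemma expect_add_right (v : G) (F : G → ℝ) : 𝔼 x, F (x + v) = 𝔼 x, F x :=
  Fintype.expect_equiv (Equiv.addRight v) _ _ fun _ => rfl

lemma expect_abs_add_nsmul_sub_rpow_le {p : ℝ} (hp : 1 ≤ p) (g : G → ℝ) (w : G) (N : ℕ) :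
    𝔼 x, |g (x + N • w) - g x| ^ p ≤ (N : ℝ) ^ p * 𝔼 x, |g (x + w) - g x| ^ p := by
  rcases Nat.eq_zero_or_pos N with rfl | hN
  · simp [Real.zero_rpow (by linarith : p ≠ 0)]
  have hN' : (0 : ℝ) < N := by exact_mod_cast hN
  have hpt : ∀ x, |g (x + N • w) - g x| ^ p ≤
      (N : ℝ) ^ (p - 1) * ∑ i ∈ range N, |g (x + i • w + w) - g (x + i • w)| ^ p := fun x => by
    have htel : g (x + N • w) - g x =
        ∑ i ∈ range N, (g (x + i • w + w) - g (x + i • w)) := by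
      have := sum_range_sub (fun i => g (x + i • w)) N
      simp only [succ_nsmul, zero_nsmul, add_zero, ← add_assoc] at this
      exact this.symm
    have hpow := Real.rpow_sum_le_const_mul_sum_rpow (range N)
      (fun i => g (x + i • w + w) - g (x + i • w)) hp
    rw [card_range] at hpow
    rw [htel]
    exact (Real.rpow_le_rpow (abs_nonneg _) (abs_sum_le_sum_abs _ _) (by linarith)).trans hpow
  calc 𝔼 x, |g (x + N • w) - g x| ^ p
      ≤ 𝔼 x, (N : ℝ) ^ (p - 1) * ∑ i ∈ range N, |g (x + i • w + w) - g (x + i • w)| ^ p :=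
        expect_le_expect fun x _ => hpt x
    _ = (N : ℝ) ^ (p - 1) * ∑ _i ∈ range N, 𝔼 x, |g (x + w) - g x| ^ p := by
        rw [← mul_expect, expect_sum_comm]
        congr 1
        exact sum_congr rfl fun i _ => expect_add_right (i • w) fun x => |g (x + w) - g x| ^ p
    _ = (N : ℝ) ^ p * 𝔼 x, |g (x + w) - g x| ^ p := by
        rw [sum_const, card_range, nsmul_eq_mul, ← mul_assoc, ← Real.rpow_add_one hN'.ne']
        norm_num

lemma expect_abs_add_two_nsmul_sub_sub_two_nsmul (p : ℝ) (g : G → ℝ) (w : G) :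
    𝔼 x, |g (x + 2 • w) - g (x - 2 • w)| ^ p = 𝔼 x, |g (x + 4 • w) - g x| ^ p := by
  rw [← expect_add_right (2 • w) fun x => |g (x + 2 • w) - g (x - 2 • w)| ^ p]
  refine expect_congr rfl fun x _ => ?_
  rw [add_sub_cancel_right, add_assoc, ← add_nsmul]

end Translation

variable {m n : ℕ}

/-- The vertex of `{-1, 1}^n`, viewed in the discrete torus, encoded by a Boolean vector. -/
def torusSign (m : ℕ) {n : ℕ} (ε : Fin n → Bool) : Fin n → ZMod (8 * m) :=
  fun j => if ε j then 1 else -1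

/-- The restriction `ε_S` of a sign vector to the coordinates in `S`. -/
def torusSignOn (m : ℕ) {n : ℕ} (S : Finset (Fin n)) (ε : Fin n → Bool) :
    Fin n → ZMod (8 * m) :=
  fun j => if j ∈ S then if ε j then 1 else -1 else 0

/-- The difference of `f` at the antipodal points `x + 2ε` and `x - 2ε`. -/
def antipodalDiff (f : (Fin n → ZMod (8 * m)) → ℝ) (x : Fin n → ZMod (8 * m))
    (ε : Fin n → Bool) : ℝ :=
  f (x + 2 • torusSign m ε) - f (x - 2 • torusSign m ε)

/-- Changing all the signs of a Boolean vector. -/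
def cubeNeg (n : ℕ) : (Fin n → Bool) ≃ (Fin n → Bool) :=
  Equiv.piCongrRight fun _ => Equiv.boolNot

lemma torusSign_cubeNeg (ε : Fin n → Bool) : torusSign m (cubeNeg n ε) = -torusSign m ε := by
  ext j
  cases h : ε j <;> simp [torusSign, cubeNeg, h]

lemma expect_antipodalDiff (f : (Fin n → ZMod (8 * m)) → ℝ) (x : Fin n → ZMod (8 * m)) :
    𝔼 ε, antipodalDiff f x ε = 0 := by
  have h : 𝔼 ε, f (x - 2 • torusSign m ε) = 𝔼 ε, f (x + 2 • torusSign m ε) :=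
    Fintype.expect_equiv (cubeNeg n) _ _ fun ε => by
      rw [torusSign_cubeNeg, smul_neg, sub_eq_add_neg]
  simp only [antipodalDiff]
  rw [expect_sub_distrib, h, sub_self]

variable [NeZero (8 * m)]

lemma smoothT_eq_expect (S : Finset (Fin n)) (f : (Fin n → ZMod (8 * m)) → ℝ)
    (x : Fin n → ZMod (8 * m)) :
    smoothT S f x = 𝔼 δ, f (x + 2 • torusSignOn m S δ) := by
  rw [Fintype.expect_eq_sum_div_card, smoothT]
  congr 1
  · refine sum_congr rfl fun δ _ => congrArg f (congrArg (x + ·) (funext fun j => ?_))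
    by_cases hj : j ∈ S <;> simp [torusSignOn, hj]
  · simp

lemma cubeCondExp_antipodalDiff (S : Finset (Fin n)) (f : (Fin n → ZMod (8 * m)) → ℝ)
    (x : Fin n → ZMod (8 * m)) (ε : Fin n → Bool) :
    cubeCondExp S (antipodalDiff f x) ε =
      smoothT Sᶜ f (x + 2 • torusSignOn m S ε) - smoothT Sᶜ f (x - 2 • torusSignOn m S ε) := by
  have hneg : 𝔼 δ, f (x - 2 • torusSignOn m S ε + 2 • torusSignOn m Sᶜ δ) =
      𝔼 δ, f (x - 2 • torusSignOn m S ε - 2 • torusSignOn m Sᶜ δ) :=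
    Fintype.expect_equiv (cubeNeg n) _ _ fun δ => by
      have : torusSignOn m Sᶜ (cubeNeg n δ) = -torusSignOn m Sᶜ δ := by
        ext j
        cases h : δ j <;> by_cases hj : j ∈ S <;> simp [torusSignOn, cubeNeg, h, hj]
      rw [this, smul_neg, sub_neg_eq_add]
  rw [smoothT_eq_expect, smoothT_eq_expect, hneg, ← expect_sub_distrib]
  refine expect_congr rfl fun δ _ => ?_
  have hsplit : torusSign m (S.piecewise ε δ) = torusSignOn m S ε + torusSignOn m Sᶜ δ := by
    ext j
    by_cases hj : j ∈ S <;> simp [torusSign, torusSignOn, hj]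
  rw [antipodalDiff, hsplit, smul_add, add_assoc, sub_sub]

lemma expect_abs_antipodalDiff_rpow_le {p : ℝ} (hp : 1 ≤ p)
    (f : (Fin n → ZMod (8 * m)) → ℝ) :
    𝔼 x, 𝔼 ε, |antipodalDiff f x ε| ^ p ≤
      4 ^ p * 𝔼 ε, 𝔼 x, |f (x + torusSign m ε) - f x| ^ p := by
  rw [expect_comm, mul_expect]
  refine expect_le_expect fun ε _ => ?_
  simp only [antipodalDiff]
  rw [expect_abs_add_two_nsmul_sub_sub_two_nsmul]
  exact_mod_cast expect_abs_add_nsmul_sub_rpow_le hp f (torusSign m ε) 4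

lemma expect_abs_cubeDeriv_antipodalDiff_rpow_le {p : ℝ} (hp : 1 ≤ p)
    (f : (Fin n → ZMod (8 * m)) → ℝ) (j : Fin n) :
    𝔼 x, 𝔼 ε, |cubeDeriv j (antipodalDiff f x) ε| ^ p ≤
      4 ^ p * 𝔼 x, |f (x + Pi.single j 1) - f x| ^ p := by
  rw [expect_comm]
  refine expect_le univ_nonempty fun ε _ => ?_
  set e : Fin n → ZMod (8 * m) := Pi.single j 1 with he
  set a := torusSign m (Function.update ε j true) with ha
  set b := torusSign m (Function.update ε j false) with hb
  have hab : 2 • a = 2 • b + 4 • e := by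
    ext i
    rcases eq_or_ne i j with rfl | hij
    · simp [ha, hb, he, torusSign]
      norm_num
    · simp [ha, hb, he, torusSign, hij]
  have hpt : ∀ x, |cubeDeriv j (antipodalDiff f x) ε| ^ p ≤
      (|f (x + 2 • b + 4 • e) - f (x + 2 • b)| ^ p +
        |f (x - 2 • a + 4 • e) - f (x - 2 • a)| ^ p) / 2 := fun x => by
    have h₁ : x + 2 • a = x + 2 • b + 4 • e := by rw [hab, add_assoc]
    have h₂ : x - 2 • b = x - 2 • a + 4 • e := by rw [hab]; abel
    have hconv := abs_expect_rpow_le (s := univ) hp fun c : Bool =>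
      if c then f (x + 2 • b + 4 • e) - f (x + 2 • b) else
        f (x - 2 • a + 4 • e) - f (x - 2 • a)
    rw [Fintype.expect_eq_sum_div_card, Fintype.expect_eq_sum_div_card] at hconv
    simp only [Fintype.sum_bool, Fintype.card_bool, Nat.cast_ofNat, if_true, Bool.false_eq_true,
      if_false] at hconv
    refine le_trans (le_of_eq ?_) hconv
    rw [cubeDeriv, antipodalDiff, antipodalDiff, ← ha, ← hb, h₁, h₂]
    congr 3
    ring
  have h4 : 𝔼 x, |f (x + 4 • e) - f x| ^ p ≤ 4 ^ p * 𝔼 x, |f (x + e) - f x| ^ p := by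
    exact_mod_cast expect_abs_add_nsmul_sub_rpow_le hp f e 4
  refine (expect_le_expect fun x _ => hpt x).trans ?_
  have h₁ := expect_add_right (2 • b) fun x => |f (x + 4 • e) - f x| ^ p
  have h₂ := expect_add_right (-(2 • a)) fun x => |f (x + 4 • e) - f x| ^ p
  simp only [← sub_eq_add_neg] at h₂
  rw [← expect_div, expect_add_distrib, h₁, h₂]
  linarith

lemma expect_abs_smoothT_sub_rpow_div_le {p : ℝ} (hp : 1 ≤ p) (S : Finset (Fin n))
    (f : (Fin n → ZMod (8 * m)) → ℝ) (ε : Fin n → Bool) :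
    𝔼 x, |smoothT Sᶜ f (x + fun j => if j ∈ S then
        4 * (m : ZMod (8 * m)) * (if ε j then 1 else -1) else 0) - smoothT Sᶜ f x| ^ p /
          (m : ℝ) ^ p ≤ 𝔼 x, |cubeCondExp S (antipodalDiff f x) ε| ^ p := by
  have hm : (0 : ℝ) < m := by
    have : 8 * m ≠ 0 := NeZero.ne _
    exact_mod_cast (by omega : 0 < m)
  have hvec : (fun j => if j ∈ S then
      4 * (m : ZMod (8 * m)) * (if ε j then 1 else -1) else 0) =
      m • (4 • torusSignOn m S ε) := by
    ext j
    by_cases hj : j ∈ S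
    · simp only [Pi.smul_apply]
      simp only [torusSignOn, hj, if_true, nsmul_eq_mul]
      push_cast
      ring
    · simp [torusSignOn, hj]
  simp_rw [cubeCondExp_antipodalDiff]
  rw [hvec, expect_abs_add_two_nsmul_sub_sub_two_nsmul, ← expect_div,
    div_le_iff₀ (by positivity), mul_comm (𝔼 x, _)]
  exact expect_abs_add_nsmul_sub_rpow_le hp _ _ _

end Torus

/-- **Lemma 2.2**: for every `p ∈ [2,∞)` there is `C = C(p) > 0` such that for all `m, n ∈ ℕ`,
`k ∈ [n]` and `f : ℤ_{8m}^n → ℝ`,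
`(1/((16m)^n binom(n,k))) Σ_{|S|=k} Σ_ε Σ_x |T_{[n]∖S} f(x + 4mε_S) - T_{[n]∖S} f(x)|^p / m^p
  ≤ C ((k/n)(1/(8m)^n) Σ_j Σ_x |f(x+e_j) - f(x)|^p
      + (k/n)^{p/2} (1/(16m)^n) Σ_ε Σ_x |f(x+ε) - f(x)|^p)`. -/
theorem smoothT_xp_with_scaling (p : ℝ) (hp : 2 ≤ p) :
    ∃ C : ℝ, 0 < C ∧ ∀ m n : ℕ, ∀ _ : NeZero (8 * m), ∀ k : ℕ, 1 ≤ k → k ≤ n →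
      ∀ f : (Fin n → ZMod (8 * m)) → ℝ,
      (∑ S ∈ powersetCard k (univ : Finset (Fin n)), ∑ ε : Fin n → Bool,
          ∑ x : Fin n → ZMod (8 * m),
          |smoothT Sᶜ f (x + fun j => if j ∈ S then
              4 * (m : ZMod (8 * m)) * (if ε j then 1 else -1) else 0) -
            smoothT Sᶜ f x| ^ p / (m : ℝ) ^ p) /
        ((16 * m : ℝ) ^ n * (n.choose k)) ≤
      C * (((k : ℝ) / n) * (∑ j : Fin n, ∑ x : Fin n → ZMod (8 * m),
            |f (x + fun i => if i = j then (1 : ZMod (8 * m)) else 0) - f x| ^ p) /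
          (8 * m : ℝ) ^ n +
        ((k : ℝ) / n) ^ (p / 2) * (∑ ε : Fin n → Bool, ∑ x : Fin n → ZMod (8 * m),
            |f (x + fun j => if ε j then (1 : ZMod (8 * m)) else -1) - f x| ^ p) /
          (16 * m : ℝ) ^ n) := by
  have hp1 : 1 ≤ p := by linarith
  refine ⟨(Real.exp (2 * (p ^ 2 + (p + 1) ^ p)) + 2 ^ (p / 2)) * 4 ^ p, by positivity, ?_⟩
  intro m n _ k hk hkn f
  set C := Real.exp (2 * (p ^ 2 + (p + 1) ^ p)) + 2 ^ (p / 2) with hC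
  have hC0 : 0 ≤ C := by positivity
  set l : ℝ := (k : ℝ) / n with hl
  have hl0 : 0 ≤ l := by positivity
  have hcube (x : Fin n → ZMod (8 * m)) :
      𝔼 S ∈ powersetCard k univ, 𝔼 ε, |cubeCondExp S (antipodalDiff f x) ε| ^ p ≤
      C * (l * ∑ j, 𝔼 ε, |cubeDeriv j (antipodalDiff f x) ε| ^ p +
        l ^ (p / 2) * 𝔼 ε, |antipodalDiff f x ε| ^ p) := by
    simpa only [Fintype.card_fin, hC, hl] using expect_powersetCard_abs_cubeCondExp_rpow_le hp hk
      (by rwa [Fintype.card_fin]) (antipodalDiff f x) (expect_antipodalDiff f x)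
  have hmain :
      𝔼 S ∈ powersetCard k univ, 𝔼 ε, 𝔼 x, |cubeCondExp S (antipodalDiff f x) ε| ^ p ≤
      C * 4 ^ p * (l * ∑ j : Fin n, 𝔼 x, |f (x + Pi.single j 1) - f x| ^ p +
        l ^ (p / 2) * 𝔼 ε, 𝔼 x, |f (x + torusSign m ε) - f x| ^ p) := by
    calc 𝔼 S ∈ powersetCard k univ, 𝔼 ε, 𝔼 x, |cubeCondExp S (antipodalDiff f x) ε| ^ p
        = 𝔼 x, 𝔼 S ∈ powersetCard k univ, 𝔼 ε, |cubeCondExp S (antipodalDiff f x) ε| ^ p := by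
          rw [expect_comm univ (powersetCard k univ)]
          exact expect_congr rfl fun S _ => expect_comm _ _ _
      _ ≤ 𝔼 x, C * (l * ∑ j, 𝔼 ε, |cubeDeriv j (antipodalDiff f x) ε| ^ p +
            l ^ (p / 2) * 𝔼 ε, |antipodalDiff f x ε| ^ p) :=
          expect_le_expect fun x _ => hcube x
      _ = C * (l * ∑ j, 𝔼 x, 𝔼 ε, |cubeDeriv j (antipodalDiff f x) ε| ^ p +
            l ^ (p / 2) * 𝔼 x, 𝔼 ε, |antipodalDiff f x ε| ^ p) := by
          rw [← mul_expect, expect_add_distrib, ← mul_expect, ← mul_expect, expect_sum_comm]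
      _ ≤ C * (l * ∑ j : Fin n, 4 ^ p * 𝔼 x, |f (x + Pi.single j 1) - f x| ^ p +
            l ^ (p / 2) * (4 ^ p * 𝔼 ε, 𝔼 x, |f (x + torusSign m ε) - f x| ^ p)) := by
          gcongr with j _
          · exact expect_abs_cubeDeriv_antipodalDiff_rpow_le hp1 f j
          · exact expect_abs_antipodalDiff_rpow_le hp1 f
      _ = _ := by
          rw [← mul_sum]
          ring
  have hsmooth := (expect_le_expect fun S (_ : S ∈ powersetCard k (univ : Finset (Fin n))) =>
    expect_le_expect fun ε (_ : ε ∈ univ) =>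
      expect_abs_smoothT_sub_rpow_div_le hp1 S f ε).trans hmain
  have hsingle (j : Fin n) :
      (Pi.single j 1 : Fin n → ZMod (8 * m)) = fun i => if i = j then 1 else 0 := by
    ext i
    simp [Pi.single_apply]
  have hsign (ε : Fin n → Bool) : torusSign m ε = fun j => if ε j then 1 else -1 := rfl
  have h16 : (16 * m : ℝ) ^ n = 2 ^ n * (8 * m) ^ n := by
    rw [← mul_pow]
    ring
  simp only [expect_eq_sum_div_card, card_powersetCard, card_univ, Fintype.card_fun,
    Fintype.card_bool, Fintype.card_fin, ZMod.card, hsingle, hsign, ← sum_div, div_div]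
    at hsmooth
  push_cast at hsmooth
  simp only [← sum_div, ← mul_div_assoc, div_div] at hsmooth ⊢
  rw [mul_comm ((8 * m : ℝ) ^ n) (2 ^ n)] at hsmooth
  rw [h16]
  convert hsmooth using 1
  congr 1
  ring
end
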